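/- Let $t \ge 4.5$ be a real number and let $G$ be a $t$-tough $(P_4 \cup P_1)$-free graph on $n$ vertices. Suppose $C$ is a cycle of $G$ with at least $\frac{3n}{t+1}$ vertices, and every vertex $x \in V(G) \setminus V(C)$ satisfies $d_G(x) \ge \frac{3n}{t+1}$. Then $G$ is Hamiltonian. -/

import Mathlib

open SimpleGraph

/-- The number of connected components of `G - S`. -/
noncomputable def ncomps {V : Type*} (G : SimpleGraph V) (S : Set V) : ℕ :=
  Nat.card (G.induce Sᶜ).ConnectedComponent

/-- The graph `P₄ ∪ P₁`: a path on four vertices plus an isolated vertex. -/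
def P4P1 : SimpleGraph (Fin 5) :=
  SimpleGraph.fromEdgeSet {s((0 : Fin 5), (1 : Fin 5)), s((1 : Fin 5), (2 : Fin 5)),
    s((2 : Fin 5), (3 : Fin 5))}

/-- `G` has no induced subgraph isomorphic to `P₄ ∪ P₁`. -/
def P4P1Free {V : Type*} (G : SimpleGraph V) : Prop := IsEmpty (P4P1 ↪g G)

/-- `G` has no induced subgraph isomorphic to `P₄`. -/
def P4Free {V : Type*} (G : SimpleGraph V) : Prop := IsEmpty (SimpleGraph.pathGraph 4 ↪g G)

/-- `G` is `t`-tough. -/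
def Tough {V : Type*} (t : ℝ) (G : SimpleGraph V) : Prop :=
  ∀ S : Set V, 2 ≤ ncomps G S → t * (ncomps G S : ℝ) ≤ (S.ncard : ℝ)

/-- `S` is a cutset of `G`, i.e. `G - S` is disconnected. -/
def IsCutset {V : Type*} (G : SimpleGraph V) (S : Set V) : Prop :=
  2 ≤ ncomps G S

/-- `S` is a scattering set of `G`. -/
def IsScatSet {V : Type*} (G : SimpleGraph V) (S : Set V) : Prop :=
  2 ≤ ncomps G S ∧ ∀ T : Set V, 2 ≤ ncomps G T →
    (ncomps G T : ℤ) - (T.ncard : ℤ) ≤ (ncomps G S : ℤ) - (S.ncard : ℤ)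

/-- `S` is a maximal scattering set of `G`. -/
def IsMaxScatSet {V : Type*} (G : SimpleGraph V) (S : Set V) : Prop :=
  IsScatSet G S ∧ ∀ T : Set V, IsScatSet G T → S ⊆ T → S = T

/-- `G` is `t`-tough with respect to `S`. -/
def ToughWrt {V : Type*} (t : ℝ) (G : SimpleGraph V) (S : Set V) : Prop :=
  ∀ W : Set V, 2 ≤ ncomps G W →
    (∀ c : (G.induce Sᶜ).ConnectedComponent,
      ∃ v : ↥Sᶜ, (G.induce Sᶜ).connectedComponentMk v = c ∧ (v : V) ∉ W) →
    t * (ncomps G W : ℝ) ≤ (W.ncard : ℝ)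

/-- `G` has no induced path on four vertices inside `A`. -/
def NoP4On {V : Type*} (G : SimpleGraph V) (A : Set V) : Prop :=
  ∀ a ∈ A, ∀ b ∈ A, ∀ c ∈ A, ∀ d ∈ A, G.Adj a b → G.Adj b c → G.Adj c d →
    ¬G.Adj a c → ¬G.Adj a d → ¬G.Adj b d → False

/-- The graph on the same vertices as `G` that keeps only the edges inside `A`. -/
def edgesWithin {V : Type*} (G : SimpleGraph V) (A : Set V) : SimpleGraph V where
  Adj x y := G.Adj x y ∧ x ∈ A ∧ y ∈ A
  symm := ⟨fun _ _ h => ⟨h.1.symm, h.2.2, h.2.1⟩⟩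
  loopless := ⟨fun _ h => G.loopless.irrefl _ h.1⟩

/-- `Ps` is a list of nonempty vertex-disjoint paths of `G` covering exactly `A`. -/
structure IsPathCover {V : Type*} (G : SimpleGraph V) (A : Finset V) (Ps : List (List V)) :
    Prop where
  isPath : ∀ P ∈ Ps, P ≠ [] ∧ P.IsChain G.Adj
  nodup : Ps.flatten.Nodup
  mem_iff : ∀ x, x ∈ Ps.flatten ↔ x ∈ A

section Reach

variable {V : Type*} {G : SimpleGraph V}

theorem edgesWithin_reachable_induction {A : Set V} {p : V → Prop} {x y : V}
    (hxy : (edgesWithin G A).Reachable x y) (hx : p x)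
    (hstep : ∀ a b, G.Adj a b → a ∈ A → b ∈ A → p a → p b) : p y := by
  rw [SimpleGraph.reachable_iff_reflTransGen] at hxy
  induction hxy with
  | refl => exact hx
  | tail _ h ih => exact hstep _ _ h.1 h.2.1 h.2.2 ih

theorem edgesWithin_adj_reachable {A : Set V} {x y : V} (h : G.Adj x y) (hx : x ∈ A)
    (hy : y ∈ A) : (edgesWithin G A).Reachable x y :=
  SimpleGraph.Adj.reachable (G := edgesWithin G A) ⟨h, hx, hy⟩

theorem edgesWithin_reachable_mono {A B : Set V} (hAB : A ⊆ B) {x y : V}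
    (h : (edgesWithin G A).Reachable x y) : (edgesWithin G B).Reachable x y :=
  SimpleGraph.Reachable.mono (G := edgesWithin G A) (G' := edgesWithin G B)
    (fun a b (hab : G.Adj a b ∧ a ∈ A ∧ b ∈ A) => ⟨hab.1, hAB hab.2.1, hAB hab.2.2⟩) h

theorem edgesWithin_reachable_of_isChain {A : Set V} {P : List V} (hP : P.IsChain G.Adj)
    (hA : ∀ x ∈ P, x ∈ A) {x y : V} (hx : x ∈ P) (hy : y ∈ P) :
    (edgesWithin G A).Reachable x y := by
  induction P generalizing x y with
  | nil => simp at hx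
  | cons a P ih =>
    have hP' := hP.of_cons
    have key : ∀ z ∈ P, (edgesWithin G A).Reachable a z := by
      intro z hz
      cases P with
      | nil => simp at hz
      | cons b P =>
        have h1 : (edgesWithin G A).Reachable a b :=
          edgesWithin_adj_reachable hP.rel (hA _ (by simp)) (hA _ (by simp))
        exact h1.trans (ih hP' (fun x hx => hA x (by simp [hx])) (by simp) hz)
    have hA' : ∀ z ∈ P, z ∈ A := fun z hz => hA z (by simp [hz])
    rcases List.mem_cons.1 hx with hx' | hx' <;> rcases List.mem_cons.1 hy with hy' | hy'
    · rw [hx', hy']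
    · rw [hx']
      exact key _ hy'
    · rw [hy']
      exact (key _ hx').symm
    · exact ih hP' hA' hx' hy'

/-- In a connected graph without induced `P₄`, distinct nonadjacent vertices have a common
neighbour. -/
theorem NoP4On.common_neighbor {A : Set V} (hA : NoP4On G A) {x y : V}
    (hxy : (edgesWithin G A).Reachable x y) (hne : x ≠ y) (hadj : ¬G.Adj x y) :
    ∃ m ∈ A, G.Adj x m ∧ G.Adj m y := by
  have key : x = y ∨ (x ∈ A ∧ G.Adj x y) ∨ (x ∈ A ∧ ∃ m ∈ A, G.Adj x m ∧ G.Adj m y) := by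
    refine edgesWithin_reachable_induction
      (p := fun y => x = y ∨ (x ∈ A ∧ G.Adj x y) ∨ (x ∈ A ∧ ∃ m ∈ A, G.Adj x m ∧ G.Adj m y))
      hxy (Or.inl rfl) ?_
    rintro y z hyz hy hz (rfl | ⟨hx, h⟩ | ⟨hx, m, hm, hxm, hmy⟩)
    · exact Or.inr (Or.inl ⟨hy, hyz⟩)
    · exact Or.inr (Or.inr ⟨hx, y, hy, h, hyz⟩)
    · by_cases h1 : G.Adj x z
      · exact Or.inr (Or.inl ⟨hx, h1⟩)
      by_cases h2 : G.Adj m z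
      · exact Or.inr (Or.inr ⟨hx, m, hm, hxm, h2⟩)
      by_cases h3 : G.Adj x y
      · exact Or.inr (Or.inr ⟨hx, y, hy, h3, hyz⟩)
      exact (hA x hx m hm y hy z hz hxm hmy hyz h3 h1 h2).elim
  rcases key with h | h | h
  · exact (hne h).elim
  · exact (hadj h.2).elim
  · exact h.2

end Reach

section Cograph

variable {V : Type*} {G : SimpleGraph V}

theorem NoP4On.mono {A B : Set V} (hB : NoP4On G B) (h : A ⊆ B) : NoP4On G A :=
  fun a ha b hb c hc d hd => hB a (h ha) b (h hb) c (h hc) d (h hd)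

theorem NoP4On.compl {A : Set V} (hA : NoP4On G A) : NoP4On Gᶜ A := by
  intro a ha b hb c hc d hd hab hbc hcd hac had hbd
  simp only [SimpleGraph.compl_adj, not_and, not_not] at *
  have h1 : a ≠ c := by rintro rfl; exact had hcd.1 |> fun h => hcd.2 h
  have h2 : b ≠ d := by rintro rfl; exact hab.2 (had hab.1)
  have h3 : a ≠ d := by rintro rfl; exact hcd.2 (hac h1).symm
  exact hA b hb d hd a ha c hc (hbd h2) (had h3).symm (hac h1) (fun h => hab.2 h.symm) hbc.2
    (fun h => hcd.2 h.symm)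

/-- `A` splits into two nonempty parts with no edges of `G` between them. -/
def Separated {V : Type*} (G : SimpleGraph V) (A : Finset V) : Prop :=
  ∃ A₁ A₂ : Finset V, A₁.Nonempty ∧ A₂.Nonempty ∧ (∀ x, x ∈ A ↔ x ∈ A₁ ∨ x ∈ A₂) ∧
    ∀ x ∈ A₁, ∀ y ∈ A₂, x ≠ y ∧ ¬G.Adj x y

theorem NoP4On.separated_insert [DecidableEq V] {A : Finset V} {v : V} (hv : v ∉ A)
    (hP4 : NoP4On G (insert v A : Finset V)) (hA : Separated G A) :
    Separated G (insert v A) ∨ Separated Gᶜ (insert v A) := by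
  classical
  obtain ⟨A₁, A₂, hA₁, hA₂, hmem, hsep⟩ := hA
  wlog h1 : ∃ x ∈ A₁, ¬G.Adj v x generalizing A₁ A₂
  · by_cases h2 : ∃ x ∈ A₂, ¬G.Adj v x
    · exact this A₂ A₁ hA₂ hA₁ (by grind)
        (fun x hx y hy => ⟨(hsep y hy x hx).1.symm, fun h => (hsep y hy x hx).2 h.symm⟩) h2
    · right
      push Not at h1 h2
      refine ⟨{v}, A, by simp, hA₁.mono (by grind), by simp, ?_⟩
      intro x hx y hy
      rw [Finset.mem_singleton.1 hx]
      have : G.Adj v y := by grind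
      exact ⟨this.ne, by simp [this]⟩
  by_cases h2 : ∃ y ∈ A₂, G.Adj v y
  swap
  · left
    push Not at h2
    refine ⟨insert v A₁, A₂, by simp, hA₂, by grind, ?_⟩
    intro x hx y hy
    rcases Finset.mem_insert.1 hx with rfl | hx
    · exact ⟨by grind, h2 y hy⟩
    · exact hsep x hx y hy
  obtain ⟨y, hy, hvy⟩ := h2
  by_cases h3 : ∃ x ∈ A₁, G.Adj v x ∧ ∃ x' ∈ A₁, ¬G.Adj v x' ∧ G.Adj x x'
  · obtain ⟨x, hx, hvx, x', hx', hvx', hxx'⟩ := h3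
    refine (hP4 y ?_ v ?_ x ?_ x' ?_ hvy.symm hvx hxx' ?_ ?_ hvx').elim
    · simp [hmem, hy]
    · simp
    · simp [hmem, hx]
    · simp [hmem, hx']
    · exact fun h => (hsep x hx y hy).2 h.symm
    · exact fun h => (hsep x' hx' y hy).2 h.symm
  · left
    push Not at h3
    refine ⟨{x ∈ A₁ | ¬G.Adj v x}, {x ∈ insert v A | x ∉ A₁ ∨ G.Adj v x}, ?_, ?_, ?_, ?_⟩
    · obtain ⟨x, hx, h⟩ := h1
      exact ⟨x, by simp [hx, h]⟩
    · exact ⟨y, by simp [hmem, hy, hvy]⟩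
    · intro x
      simp only [Finset.mem_insert, Finset.mem_filter, hmem]
      grind
    · intro x hx z hz
      simp only [Finset.mem_insert, Finset.mem_filter, hmem] at hx hz
      have hvz : z = v ∨ z ∈ A₂ ∨ (z ∈ A₁ ∧ G.Adj v z) := by grind
      rcases hvz with rfl | hz' | ⟨hz', hvz⟩
      · exact ⟨by grind, fun h => hx.2 h.symm⟩
      · exact hsep x hx.1 z hz'
      · exact ⟨by grind, fun h => h3 z hz' hvz x hx.1 hx.2 h.symm⟩

/-- A graph without induced `P₄` on at least two vertices is disconnected or
co-disconnected. -/
theorem NoP4On.separated_or_compl [DecidableEq V] (A : Finset V) (hP4 : NoP4On G A)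
    (hcard : 2 ≤ A.card) : Separated G A ∨ Separated Gᶜ A := by
  induction A using Finset.induction_on with
  | empty => simp at hcard
  | insert v A hv ih =>
    by_cases hA : 2 ≤ A.card
    · rcases ih (hP4.mono (by simp)) hA with h | h
      · exact hP4.separated_insert hv h
      · have := hP4.compl.separated_insert hv h
        rw [compl_compl] at this
        exact this.symm
    · rw [Finset.card_insert_of_notMem hv] at hcard
      obtain ⟨a, rfl⟩ := Finset.card_eq_one.1 (show A.card = 1 by omega)
      have hne : v ≠ a := by simpa using hv
      by_cases hva : G.Adj v a
      · refine Or.inr ⟨{v}, {a}, by simp, by simp, by simp, ?_⟩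
        simp [hne, hva]
      · refine Or.inl ⟨{v}, {a}, by simp, by simp, by simp, ?_⟩
        simp [hne, hva]

end Cograph

section PathCover

variable {V : Type*} {G : SimpleGraph V}

theorem exists_isChain_refinement {α : Type*} {R : α → α → Prop} {Ps : List (List α)}
    (hPs : ∀ P ∈ Ps, P ≠ [] ∧ P.IsChain R) {m : ℕ} (hm : Ps.length ≤ m)
    (hm' : m ≤ Ps.flatten.length) :
    ∃ Qs : List (List α), Qs.length = m ∧ Qs.flatten = Ps.flatten ∧
      ∀ P ∈ Qs, P ≠ [] ∧ P.IsChain R := by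
  induction m, hm using Nat.le_induction with
  | base => exact ⟨Ps, rfl, rfl, hPs⟩
  | succ m hm ih =>
    obtain ⟨Qs, hlen, hflat, hQs⟩ := ih (by omega)
    have hlong : ∃ P ∈ Qs, 2 ≤ P.length := by
      by_contra! h
      have : Qs.flatten.length ≤ Qs.length := by
        rw [List.length_flatten]
        calc (Qs.map List.length).sum ≤ (Qs.map List.length).length • 1 := by
              apply List.sum_le_card_nsmul
              intro x hx
              obtain ⟨P, hP, rfl⟩ := List.mem_map.1 hx
              have := h P hP
              omega
          _ = Qs.length := by simp
      rw [hflat] at this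
      omega
    obtain ⟨P, hP, hP2⟩ := hlong
    obtain ⟨As, Bs, rfl⟩ := List.append_of_mem hP
    match P, hP2 with
    | x :: y :: P, _ =>
      refine ⟨As ++ [x] :: (y :: P) :: Bs, by simp at hlen ⊢; omega, by simp [← hflat], ?_⟩
      intro Q hQ
      have h0 := hQs (x :: y :: P) (by simp)
      simp only [List.mem_append, List.mem_cons] at hQ
      rcases hQ with hQ | rfl | rfl | hQ
      · exact hQs Q (by simp [hQ])
      · simp
      · exact ⟨by simp, h0.2.of_cons⟩
      · exact hQs Q (by simp [hQ])

theorem exists_isChain_interleave {A₁ A₂ : Set V} (hadj : ∀ x ∈ A₁, ∀ y ∈ A₂, G.Adj x y)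
    (Ps Qs : List (List V)) (hlen : Ps.length = Qs.length)
    (hPs : ∀ P ∈ Ps, P ≠ [] ∧ P.IsChain G.Adj) (hQs : ∀ P ∈ Qs, P ≠ [] ∧ P.IsChain G.Adj)
    (hP : ∀ P ∈ Ps, ∀ x ∈ P, x ∈ A₁) (hQ : ∀ P ∈ Qs, ∀ x ∈ P, x ∈ A₂) :
    ∃ L : List V, L.IsChain G.Adj ∧ L.Perm (Ps.flatten ++ Qs.flatten) ∧
      (∀ x ∈ L.head?, x ∈ A₁) ∧ ∀ x ∈ L.getLast?, x ∈ A₂ := by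
  induction Ps generalizing Qs with
  | nil =>
    rw [List.eq_nil_of_length_eq_zero hlen.symm]
    exact ⟨[], by simp⟩
  | cons P Ps ih =>
    cases Qs with
    | nil => simp at hlen
    | cons Q Qs =>
      obtain ⟨L, hL, hperm, hhead, hlast⟩ := ih Qs (by simpa using hlen)
        (fun R hR => hPs R (by simp [hR])) (fun R hR => hQs R (by simp [hR]))
        (fun R hR => hP R (by simp [hR])) (fun R hR => hQ R (by simp [hR]))
      have hP0 := hPs P (by simp)
      have hQ0 := hQs Q (by simp)
      have hPA := hP P (by simp)
      have hQA := hQ Q (by simp)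
      refine ⟨P ++ (Q ++ L), ?_, ?_, ?_, ?_⟩
      · refine hP0.2.append (hQ0.2.append hL ?_) ?_
        · intro x hx y hy
          exact (hadj y (hhead y hy) x (hQA x (List.mem_of_getLast? hx))).symm
        · intro x hx y hy
          rw [List.head?_append_of_ne_nil _ hQ0.1] at hy
          exact hadj x (hPA x (List.mem_of_getLast? hx)) y (hQA y (List.mem_of_head? hy))
      · classical
        rw [List.perm_iff_count] at hperm ⊢
        intro a
        have := hperm a
        simp only [List.flatten_cons, List.count_append] at this ⊢
        omega
      · intro x hx
        rw [List.head?_append_of_ne_nil _ hP0.1] at hx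
        exact hPA x (List.mem_of_head? hx)
      · intro x hx
        rw [← List.append_assoc, List.getLast?_append] at hx
        cases hL' : L.getLast? with
        | none =>
          rw [hL'] at hx
          simp only [Option.none_or] at hx
          rw [List.getLast?_append_of_ne_nil _ hQ0.1] at hx
          exact hQA x (List.mem_of_getLast? hx)
        | some z =>
          rw [hL'] at hx
          simp only [Option.some_or] at hx
          exact hlast x (by rw [hL']; exact hx)

theorem IsPathCover.length_flatten {A : Finset V} {Ps : List (List V)}
    (h : IsPathCover G A Ps) : Ps.flatten.length = A.card := by
  classical
  rw [← List.toFinset_card_of_nodup h.nodup]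
  congr 1
  ext x
  simpa using h.mem_iff x

theorem IsPathCover.length_le {A : Finset V} {Ps : List (List V)}
    (h : IsPathCover G A Ps) : Ps.length ≤ A.card := by
  rw [← h.length_flatten, List.length_flatten]
  have : (Ps.map List.length).length • 1 ≤ (Ps.map List.length).sum := by
    apply List.card_nsmul_le_sum
    intro x hx
    obtain ⟨P, hP, rfl⟩ := List.mem_map.1 hx
    exact List.length_pos_iff.2 (h.isPath P hP).1
  simpa using this

theorem IsPathCover.singletons (G : SimpleGraph V) (A : Finset V) :
    IsPathCover G A (A.toList.map fun x => [x]) := by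
  have : (A.toList.map fun x => [x]).flatten = A.toList := by
    rw [← List.flatMap_def]; simp
  refine ⟨by simp, ?_, ?_⟩
  · rw [this]; exact A.nodup_toList
  · rw [this]; simp

theorem IsPathCover.refine {A : Finset V} {Ps : List (List V)} (h : IsPathCover G A Ps)
    {m : ℕ} (hm : Ps.length ≤ m) (hm' : m ≤ A.card) :
    ∃ Qs, IsPathCover G A Qs ∧ Qs.length = m := by
  obtain ⟨Qs, h1, h2, h3⟩ := exists_isChain_refinement h.isPath hm (h.length_flatten ▸ hm')
  exact ⟨Qs, ⟨h3, h2 ▸ h.nodup, h2 ▸ h.mem_iff⟩, h1⟩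

theorem IsPathCover.of_append_perm {A A₁ A₂ : Finset V} {Ps Qs Rs : List (List V)}
    (hP : IsPathCover G A₁ Ps) (hQ : IsPathCover G A₂ Qs)
    (hdisj : ∀ x ∈ A₁, x ∉ A₂) (hA : ∀ x, x ∈ A ↔ x ∈ A₁ ∨ x ∈ A₂)
    (hR : ∀ P ∈ Rs, P ≠ [] ∧ P.IsChain G.Adj)
    (hperm : Rs.flatten.Perm (Ps.flatten ++ Qs.flatten)) : IsPathCover G A Rs := by
  refine ⟨hR, ?_, fun x => ?_⟩
  · rw [hperm.nodup_iff, List.nodup_append]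
    refine ⟨hP.nodup, hQ.nodup, ?_⟩
    intro a ha b hb hab
    exact hdisj a ((hP.mem_iff a).1 ha) (hab ▸ (hQ.mem_iff b).1 hb)
  · rw [hperm.mem_iff, List.mem_append, hP.mem_iff, hQ.mem_iff, hA]

/-- A path cover together with a certificate of its optimality. -/
def HasTightPathCover {V : Type*} (G : SimpleGraph V) (A : Finset V) : Prop :=
  ∃ Ps : List (List V), ∃ T I : Finset V, IsPathCover G A Ps ∧ T ⊆ A ∧
    (∀ x ∈ I, x ∈ A ∧ x ∉ T) ∧
    (∀ x ∈ I, ∀ y ∈ I, x ≠ y →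
      ¬(edgesWithin G {z | z ∈ A ∧ z ∉ T}).Reachable x y) ∧
    Ps.length + T.card ≤ I.card

theorem HasTightPathCover.union [DecidableEq V] {A A₁ A₂ : Finset V}
    (h₁ : HasTightPathCover G A₁) (h₂ : HasTightPathCover G A₂)
    (hA : ∀ x, x ∈ A ↔ x ∈ A₁ ∨ x ∈ A₂) (hsep : ∀ x ∈ A₁, ∀ y ∈ A₂, x ≠ y ∧ ¬G.Adj x y) :
    HasTightPathCover G A := by
  obtain ⟨Ps, T₁, I₁, hP, hT₁, hI₁, hr₁, hc₁⟩ := h₁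
  obtain ⟨Qs, T₂, I₂, hQ, hT₂, hI₂, hr₂, hc₂⟩ := h₂
  have hdisj : ∀ x ∈ A₁, x ∉ A₂ := fun x h1 h2 => (hsep x h1 x h2).1 rfl
  have stay₁ : ∀ x y, x ∈ A₁ →
      (edgesWithin G {z | z ∈ A ∧ z ∉ T₁ ∪ T₂}).Reachable x y →
      y ∈ A₁ ∧ (edgesWithin G {z | z ∈ A₁ ∧ z ∉ T₁}).Reachable x y := by
    intro x y hx hxy
    refine edgesWithin_reachable_induction (p := fun y => y ∈ A₁ ∧
      (edgesWithin G {z | z ∈ A₁ ∧ z ∉ T₁}).Reachable x y) hxy ⟨hx, .refl _⟩ ?_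
    rintro a b hab ⟨ha, ha'⟩ ⟨hb, hb'⟩ ⟨h1, h2⟩
    have hb1 : b ∈ A₁ := by
      rcases (hA b).1 hb with h | h
      · exact h
      · exact ((hsep a h1 b h).2 hab).elim
    exact ⟨hb1, h2.trans (edgesWithin_adj_reachable hab (by grind) (by grind))⟩
  have stay₂ : ∀ x y, x ∈ A₂ →
      (edgesWithin G {z | z ∈ A ∧ z ∉ T₁ ∪ T₂}).Reachable x y →
      y ∈ A₂ ∧ (edgesWithin G {z | z ∈ A₂ ∧ z ∉ T₂}).Reachable x y := by
    intro x y hx hxy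
    refine edgesWithin_reachable_induction (p := fun y => y ∈ A₂ ∧
      (edgesWithin G {z | z ∈ A₂ ∧ z ∉ T₂}).Reachable x y) hxy ⟨hx, .refl _⟩ ?_
    rintro a b hab ⟨ha, ha'⟩ ⟨hb, hb'⟩ ⟨h1, h2⟩
    have hb1 : b ∈ A₂ := by
      rcases (hA b).1 hb with h | h
      · exact ((hsep b h a h1).2 hab.symm).elim
      · exact h
    exact ⟨hb1, h2.trans (edgesWithin_adj_reachable hab (by grind) (by grind))⟩
  refine ⟨Ps ++ Qs, T₁ ∪ T₂, I₁ ∪ I₂, ?_, ?_, ?_, ?_, ?_⟩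
  · refine hP.of_append_perm hQ hdisj hA ?_ (by simp)
    intro P h
    rcases List.mem_append.1 h with h | h
    · exact hP.isPath P h
    · exact hQ.isPath P h
  · intro x hx
    grind
  · intro x hx
    have := hdisj x
    rw [Finset.mem_union] at hx
    rw [hA, Finset.mem_union]
    rcases hx with hx | hx
    · have := hI₁ x hx; have := @hT₂ x; tauto
    · have := hI₂ x hx; have := @hT₁ x; tauto
  · intro x hx y hy hne hxy
    rcases Finset.mem_union.1 hx with hx | hx <;> rcases Finset.mem_union.1 hy with hy | hy
    · exact hr₁ x hx y hy hne (stay₁ x y (hI₁ x hx).1 hxy).2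
    · exact hdisj y (stay₁ x y (hI₁ x hx).1 hxy).1 (hI₂ y hy).1
    · exact hdisj y (hI₁ y hy).1 (stay₂ x y (hI₂ x hx).1 hxy).1
    · exact hr₂ x hx y hy hne (stay₂ x y (hI₂ x hx).1 hxy).2
  · have hd : Disjoint I₁ I₂ := Finset.disjoint_left.2 fun x h1 h2 =>
      hdisj x (hI₁ x h1).1 (hI₂ x h2).1
    rw [Finset.card_union_of_disjoint hd, List.length_append]
    have := Finset.card_union_le T₁ T₂
    omega

theorem HasTightPathCover.join_of_lt [DecidableEq V] {A A₁ A₂ : Finset V}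
    {Qs : List (List V)} {T₂ I₂ : Finset V} (hQ : IsPathCover G A₂ Qs) (hT₂ : T₂ ⊆ A₂)
    (hI₂ : ∀ x ∈ I₂, x ∈ A₂ ∧ x ∉ T₂)
    (hr₂ : ∀ x ∈ I₂, ∀ y ∈ I₂, x ≠ y →
      ¬(edgesWithin G {z | z ∈ A₂ ∧ z ∉ T₂}).Reachable x y)
    (hc₂ : Qs.length + T₂.card ≤ I₂.card)
    (hA : ∀ x, x ∈ A ↔ x ∈ A₁ ∨ x ∈ A₂) (hjoin : ∀ x ∈ A₁, ∀ y ∈ A₂, G.Adj x y)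
    (hlt : A₁.card < Qs.length) : HasTightPathCover G A := by
  have hdisj : ∀ x ∈ A₁, x ∉ A₂ := fun x h1 h2 => G.loopless.irrefl _ (hjoin x h1 x h2)
  obtain ⟨Q, Qs, rfl⟩ : ∃ Q Qs', Qs = Q :: Qs' := by
    cases Qs with
    | nil => simp at hlt
    | cons Q Qs => exact ⟨Q, Qs, rfl⟩
  have hS := IsPathCover.singletons G A₁
  have hlen : (A₁.toList.map fun x => [x]).length = (Qs.take A₁.card).length := by
    simp at hlt ⊢; omega
  have hQmem : ∀ P ∈ Q :: Qs, ∀ x ∈ P, x ∈ A₂ := fun P hP x hx =>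
    (hQ.mem_iff x).1 (List.mem_flatten.2 ⟨P, hP, hx⟩)
  have htake : ∀ P ∈ Qs.take A₁.card, P ∈ Q :: Qs := fun P hP => by
    simp [List.mem_of_mem_take hP]
  obtain ⟨L, hL, hperm, hhead, -⟩ := exists_isChain_interleave (A₁ := A₁) (A₂ := A₂)
    hjoin _ _ hlen hS.isPath (fun P hP => hQ.isPath P (htake P hP))
    (fun P hP x hx => (hS.mem_iff x).1 (List.mem_flatten.2 ⟨P, hP, hx⟩))
    (fun P hP => hQmem P (htake P hP))
  have hQ0 := hQ.isPath Q (by simp)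
  refine ⟨(Q ++ L) :: Qs.drop A₁.card, A₁ ∪ T₂, I₂, ?_, ?_, ?_, ?_, ?_⟩
  · refine hS.of_append_perm hQ hdisj hA ?_ ?_
    · intro P hP
      rcases List.mem_cons.1 hP with rfl | hP
      · refine ⟨by simp [hQ0.1], hQ0.2.append hL ?_⟩
        intro x hx y hy
        exact (hjoin y (hhead y hy) x (hQmem Q (by simp) x (List.mem_of_getLast? hx))).symm
      · exact hQ.isPath P (by simp [List.mem_of_mem_drop hP])
    · rw [List.perm_iff_count] at hperm ⊢
      intro a
      have h1 := hperm a
      have h2 : Qs.flatten.count a =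
          (Qs.take A₁.card).flatten.count a + (Qs.drop A₁.card).flatten.count a := by
        rw [← List.count_append, ← List.flatten_append, List.take_append_drop]
      simp only [List.flatten_cons, List.count_append] at h1 ⊢
      omega
  · intro x hx
    grind
  · intro x hx
    have := hI₂ x hx
    have := hdisj x
    rw [hA, Finset.mem_union]
    tauto
  · intro x hx y hy hne hxy
    refine hr₂ x hx y hy hne (edgesWithin_reachable_mono ?_ hxy)
    rintro z ⟨h1, h2⟩
    rw [hA] at h1
    rw [Finset.mem_union] at h2
    exact ⟨by tauto, by tauto⟩
  · have := Finset.card_union_le A₁ T₂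
    simp only [List.length_cons, List.length_drop] at hlt hc₂ ⊢
    omega

theorem HasTightPathCover.join [DecidableEq V] {A A₁ A₂ : Finset V} (hne : A₁.Nonempty)
    (h₁ : HasTightPathCover G A₁) (h₂ : HasTightPathCover G A₂)
    (hA : ∀ x, x ∈ A ↔ x ∈ A₁ ∨ x ∈ A₂) (hjoin : ∀ x ∈ A₁, ∀ y ∈ A₂, G.Adj x y) :
    HasTightPathCover G A := by
  obtain ⟨Ps, T₁, I₁, hP, hT₁, hI₁, hr₁, hc₁⟩ := h₁
  obtain ⟨Qs, T₂, I₂, hQ, hT₂, hI₂, hr₂, hc₂⟩ := h₂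
  by_cases hlt₂ : A₁.card < Qs.length
  · exact .join_of_lt hQ hT₂ hI₂ hr₂ hc₂ hA hjoin hlt₂
  by_cases hlt₁ : A₂.card < Ps.length
  · exact .join_of_lt hP hT₁ hI₁ hr₁ hc₁ (fun x => (hA x).trans or_comm)
      (fun x hx y hy => (hjoin y hy x hx).symm) hlt₁
  have hdisj : ∀ x ∈ A₁, x ∉ A₂ := fun x h1 h2 => G.loopless.irrefl _ (hjoin x h1 x h2)
  have hle₁ := hP.length_le
  have hle₂ := hQ.length_le
  obtain ⟨Ps', hP', hlenP⟩ := hP.refine (m := max Ps.length Qs.length) (by omega) (by omega)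
  obtain ⟨Qs', hQ', hlenQ⟩ := hQ.refine (m := max Ps.length Qs.length) (by omega) (by omega)
  obtain ⟨L, hL, hperm, -, -⟩ := exists_isChain_interleave (A₁ := A₁) (A₂ := A₂)
    hjoin _ _ (hlenP.trans hlenQ.symm) hP'.isPath hQ'.isPath
    (fun P hP x hx => (hP'.mem_iff x).1 (List.mem_flatten.2 ⟨P, hP, hx⟩))
    (fun P hP x hx => (hQ'.mem_iff x).1 (List.mem_flatten.2 ⟨P, hP, hx⟩))
  obtain ⟨x, hx⟩ := hne
  have hxL : x ∈ L := by
    rw [hperm.mem_iff, List.mem_append, hP'.mem_iff]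
    exact Or.inl hx
  refine ⟨[L], ∅, {x}, ?_, by simp, by simp [hA, hx], ?_, by simp⟩
  · refine hP'.of_append_perm hQ' hdisj hA ?_ (by simpa using hperm)
    intro P h
    rw [List.mem_singleton.1 h]
    exact ⟨List.ne_nil_of_mem hxL, hL⟩
  · intro y hy z hz hyz
    simp only [Finset.mem_singleton] at hy hz
    exact (hyz (hy.trans hz.symm)).elim

/-- A graph without induced `P₄` has a path cover whose size is certified by a scattering
set. -/
theorem NoP4On.hasTightPathCover [DecidableEq V] (A : Finset V) (hP4 : NoP4On G A) :
    HasTightPathCover G A := by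
  induction hn : A.card using Nat.strong_induction_on generalizing A with
  | _ n ih =>
  by_cases h2 : 2 ≤ A.card
  · have key : ∀ A₁ A₂ : Finset V, A₁.Nonempty → A₂.Nonempty →
        (∀ x, x ∈ A ↔ x ∈ A₁ ∨ x ∈ A₂) → (∀ x ∈ A₁, ∀ y ∈ A₂, x ≠ y) →
        HasTightPathCover G A₁ ∧ HasTightPathCover G A₂ := by
      rintro A₁ A₂ ⟨a, ha⟩ ⟨b, hb⟩ hA hne
      constructor
      · refine ih A₁.card ?_ A₁ (hP4.mono fun x hx => (hA x).2 (Or.inl hx)) rfl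
        rw [← hn]
        exact Finset.card_lt_card ⟨fun x hx => (hA x).2 (Or.inl hx),
          fun h => hne b (h ((hA b).2 (Or.inr hb))) b hb rfl⟩
      · refine ih A₂.card ?_ A₂ (hP4.mono fun x hx => (hA x).2 (Or.inr hx)) rfl
        rw [← hn]
        exact Finset.card_lt_card ⟨fun x hx => (hA x).2 (Or.inr hx),
          fun h => hne a ha a (h ((hA a).2 (Or.inl ha))) rfl⟩
    rcases hP4.separated_or_compl A h2 with ⟨A₁, A₂, h1, h2, hA, hs⟩ | ⟨A₁, A₂, h1, h2, hA, hs⟩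
    · obtain ⟨k1, k2⟩ := key A₁ A₂ h1 h2 hA fun x hx y hy => (hs x hx y hy).1
      exact k1.union k2 hA hs
    · obtain ⟨k1, k2⟩ := key A₁ A₂ h1 h2 hA fun x hx y hy => (hs x hx y hy).1
      refine k1.join h1 k2 hA fun x hx y hy => ?_
      have := hs x hx y hy
      by_contra h
      exact this.2 ⟨this.1, h⟩
  · refine ⟨A.toList.map fun x => [x], ∅, A, .singletons G A, by simp, by simp, ?_, by simp⟩
    intro x hx y hy hne
    exact (hne (Finset.card_le_one.1 (by omega) x hx y hy)).elim

end PathCover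

section Interfaces

variable {V : Type*} {G : SimpleGraph V}

/-- Pairwise separated vertices outside `X` bound the number of components of `G - X`. -/
theorem Tough.mul_card_le [Fintype V] {t : ℝ} (ht : 0 ≤ t) (htough : Tough t G)
    {X I : Finset V} (hI : ∀ x ∈ I, x ∉ X)
    (hr : ∀ x ∈ I, ∀ y ∈ I, x ≠ y → ¬(edgesWithin G {z | z ∉ X}).Reachable x y)
    (h2 : 2 ≤ I.card) : t * I.card ≤ X.card := by
  classical
  have hle : I.card ≤ ncomps G (X : Set V) := by
    let f : I → (G.induce (X : Set V)ᶜ).ConnectedComponent := fun x =>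
      (G.induce (X : Set V)ᶜ).connectedComponentMk ⟨x, by simpa using hI x x.2⟩
    have hf : Function.Injective f := by
      intro x y hxy
      by_contra hne
      have h := (SimpleGraph.ConnectedComponent.eq.1 hxy)
      let g : G.induce (X : Set V)ᶜ →g edgesWithin G {z | z ∉ X} :=
        ⟨Subtype.val, fun {a b} h => ⟨h, a.2, b.2⟩⟩
      exact hr x x.2 y y.2 (fun h => hne (Subtype.ext h)) (h.map g)
    have := Nat.card_le_card_of_injective f hf
    simpa [ncomps] using this
  have h := htough (X : Set V) (h2.trans hle)
  rw [Set.ncard_coe_finset] at h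
  exact (mul_le_mul_of_nonneg_left (Nat.cast_le.2 hle) ht).trans h

theorem P4P1Free.not_isolated (hG : P4P1Free G) {a b c d e : V} (hab : G.Adj a b)
    (hbc : G.Adj b c) (hcd : G.Adj c d) (hac : ¬G.Adj a c) (had : ¬G.Adj a d)
    (hbd : ¬G.Adj b d) (hea : ¬G.Adj e a) (heb : ¬G.Adj e b) (hec : ¬G.Adj e c)
    (hed : ¬G.Adj e d) : False := by
  have hac' : a ≠ c := by rintro rfl; exact had hcd
  have had' : a ≠ d := by rintro rfl; exact hac hcd.symm
  have hbd' : b ≠ d := by rintro rfl; exact had hab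
  have hea' : e ≠ a := by rintro rfl; exact heb hab
  have heb' : e ≠ b := by rintro rfl; exact hea hab.symm
  have hec' : e ≠ c := by rintro rfl; exact heb hbc.symm
  have hed' : e ≠ d := by rintro rfl; exact hec hcd.symm
  have hinj : Function.Injective ![a, b, c, d, e] := by
    intro i j
    fin_cases i <;> fin_cases j <;>
      simp [hab.ne, hab.ne', hbc.ne, hbc.ne', hcd.ne, hcd.ne', hac', hac'.symm, had', had'.symm,
        hbd', hbd'.symm, hea', hea'.symm, heb', heb'.symm, hec', hec'.symm, hed', hed'.symm]
  refine hG.false ⟨⟨![a, b, c, d, e], hinj⟩, ?_⟩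
  intro i j
  have := G.adj_comm
  fin_cases i <;> fin_cases j <;>
    simp [P4P1, hab, hbc, hcd, hab.symm, hbc.symm, hcd.symm, hac, had, hbd, hea, heb, hec, hed,
      this c a, this d a, this d b, this a e, this b e, this c e, this d e]

/-- The vertices of `l`, in this order, form a cycle of `G`. -/
structure IsCycleList {V : Type*} (G : SimpleGraph V) (l : List V) : Prop where
  nodup : l.Nodup
  three_le : 3 ≤ l.length
  isChain : l.IsChain G.Adj
  closed : ∀ x ∈ l.getLast?, ∀ y ∈ l.head?, G.Adj x y

theorem IsCycleList.of_isCycle {v : V} {C : G.Walk v v} (hC : C.IsCycle) :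
    IsCycleList G C.support.tail := by
  refine ⟨hC.support_nodup, by simpa using hC.three_le_length, C.isChain_adj_support.tail, ?_⟩
  cases C with
  | nil => simp at hC
  | cons h p =>
    intro x hx y hy
    simp only [SimpleGraph.Walk.support_cons, List.tail_cons] at hx hy
    rw [List.getLast?_eq_some_getLast (by simp), Option.mem_def, Option.some_inj] at hx
    rw [List.head?_eq_some_head (by simp), Option.mem_def, Option.some_inj] at hy
    rw [SimpleGraph.Walk.getLast_support] at hx
    rw [SimpleGraph.Walk.head_support] at hy
    rw [← hx, ← hy]
    exact h

theorem IsCycleList.exists_isHamiltonianCycle [Fintype V] [DecidableEq V] {l : List V}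
    (hl : IsCycleList G l) (hall : ∀ x, x ∈ l) :
    ∃ a, ∃ p : G.Walk a a, p.IsHamiltonianCycle := by
  have hne : l ≠ [] := by
    rintro rfl
    simpa using hl.three_le
  have hadj : G.Adj (l.getLast hne) (l.head hne) :=
    hl.closed _ (by simp [List.getLast?_eq_some_getLast hne]) _
      (by simp [List.head?_eq_some_head hne])
  have hlen : l.length = Fintype.card V := by
    rw [← List.toFinset_card_of_nodup hl.nodup]
    congr 1
    ext x
    simpa using hall x
  have h3 := hl.three_le
  let p := SimpleGraph.Walk.ofSupport l hne hl.isChain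
  have hp : p.support = l := SimpleGraph.Walk.support_ofSupport hne hl.isChain
  have hplen : p.length + 1 = l.length := by
    rw [← SimpleGraph.Walk.length_support]
    exact congrArg List.length hp
  refine ⟨_, SimpleGraph.Walk.cons hadj p, ?_⟩
  rw [SimpleGraph.Walk.isHamiltonianCycle_iff_isCycle_and_length_eq,
    SimpleGraph.Walk.isCycle_iff_isPath_tail_and_le_length]
  refine ⟨⟨?_, ?_⟩, ?_⟩
  · exact SimpleGraph.Walk.IsPath.mk' (by
      rw [SimpleGraph.Walk.support_tail_of_not_nil _ (by simp), SimpleGraph.Walk.support_cons,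
        List.tail_cons, hp]
      exact hl.nodup)
  · rw [SimpleGraph.Walk.length_cons]
    omega
  · rw [SimpleGraph.Walk.length_cons]
    omega

theorem IsCycleList.exists_longest [Fintype V] {l : List V} (hl : IsCycleList G l) :
    ∃ l', IsCycleList G l' ∧ ∀ l'', IsCycleList G l'' → l''.length ≤ l'.length := by
  classical
  let P : ℕ → Prop := fun n => ∃ l, IsCycleList G l ∧ l.length = n
  have hb : ∀ l, IsCycleList G l → l.length ≤ Fintype.card V := fun l h => h.nodup.length_le_card
  obtain ⟨l', hl', hlen⟩ : P (Nat.findGreatest P (Fintype.card V)) :=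
    Nat.findGreatest_spec (P := P) (hb l hl) ⟨l, hl, rfl⟩
  exact ⟨l', hl', fun l'' h => hlen ▸ Nat.le_findGreatest (hb l'' h) ⟨l'', h, rfl⟩⟩

theorem exists_isChain_of_reachable {A : Set V} {x y : V}
    (h : (edgesWithin G A).Reachable x y) :
    ∃ P : List V, P.Nodup ∧ P.IsChain G.Adj ∧ P.head? = some x ∧ P.getLast? = some y ∧
      ∀ z ∈ P, (edgesWithin G A).Reachable x z := by
  classical
  obtain ⟨p, hp⟩ := h.exists_isPath
  refine ⟨p.support, hp.support_nodup, p.isChain_adj_support.imp fun _ _ h => h.1, ?_, ?_, ?_⟩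
  · rw [List.head?_eq_some_head (by simp), SimpleGraph.Walk.head_support]
  · rw [List.getLast?_eq_some_getLast (by simp), SimpleGraph.Walk.getLast_support]
  · exact fun z hz => ⟨p.takeUntil z hz⟩

/-- The vertices outside `D` with a neighbour in `D`. -/
def outerBoundary {V : Type*} (G : SimpleGraph V) (D : Set V) : Set V :=
  {u | u ∉ D ∧ ∃ d ∈ D, G.Adj u d}

/-- Joining the ends of a path through a connected set `D` outside it gives a cycle. -/
theorem exists_isCycleList_of_outerBoundary {A D : Set V} {x₀ : V}
    (hD : ∀ d, d ∈ D ↔ (edgesWithin G A).Reachable x₀ d) {M : List V} (hM : M.Nodup)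
    (hchain : M.IsChain G.Adj) (hMD : ∀ x ∈ M, x ∉ D) {u v : V} (hu : M.head? = some u)
    (hv : M.getLast? = some v) (huD : u ∈ outerBoundary G D) (hvD : v ∈ outerBoundary G D)
    (h3 : 2 ≤ M.length) :
    ∃ l, IsCycleList G l ∧ M.length < l.length := by
  obtain ⟨-, d, hd, hud⟩ := huD
  obtain ⟨-, e, he, hve⟩ := hvD
  rw [hD] at hd he
  obtain ⟨P, hP, hPc, hPh, hPl, hPr⟩ := exists_isChain_of_reachable (he.symm.trans hd)
  have hPD : ∀ z ∈ P, z ∈ D := fun z hz => (hD z).2 (he.trans (hPr z hz))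
  have hPne : P ≠ [] := by rintro rfl; simp at hPh
  have hPpos := List.length_pos_iff.2 hPne
  have hMne : M ≠ [] := by rintro rfl; simp at hu
  refine ⟨M ++ P, ⟨?_, ?_, ?_, ?_⟩, ?_⟩
  · rw [List.nodup_append]
    refine ⟨hM, hP, ?_⟩
    rintro a ha _ hb rfl
    exact hMD a ha (hPD a hb)
  · rw [List.length_append]; omega
  · refine hchain.append hPc ?_
    intro x hx y hy
    rw [hv] at hx
    rw [hPh] at hy
    obtain rfl : v = x := by simpa using hx
    obtain rfl : e = y := by simpa using hy
    exact hve
  · intro x hx y hy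
    rw [List.getLast?_append_of_ne_nil _ hPne, hPl] at hx
    rw [List.head?_append_of_ne_nil _ hMne, hu] at hy
    obtain rfl : d = x := by simpa using hx
    obtain rfl : u = y := by simpa using hy
    exact hud.symm
  · rw [List.length_append]; omega

end Interfaces

/-- A cyclic sequence `c` of period `N` together with a nonempty set `D` outside it, all of whose
outside neighbours lie on the cycle, such that no path of length at least `N` outside `D` can be
closed up through `D`. -/
structure IsObstruction {V : Type*} (G : SimpleGraph V) (N : ℕ) (c : ℕ → V) (D : Set V) :
    Prop where
  three_le : 3 ≤ N
  adj : ∀ i, G.Adj (c i) (c (i + 1))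
  periodic : ∀ i, c (i + N) = c i
  inj : ∀ i j, i < N → j < N → c i = c j → i = j
  notMem : ∀ i, c i ∉ D
  nonempty : D.Nonempty
  cover : ∀ x ∈ outerBoundary G D, ∃ i, c i = x
  zero_mem : c 0 ∈ outerBoundary G D
  not_closable : ∀ (M : List V) (u v : V), M.Nodup → M.IsChain G.Adj → (∀ x ∈ M, x ∉ D) →
    N ≤ M.length → M.head? = some u → M.getLast? = some v → u ∈ outerBoundary G D →
    v ∈ outerBoundary G D → False

open Classical in
/-- The successor of a vertex in the sequence `c`. -/
noncomputable def nextOn {V : Type*} (c : ℕ → V) (u : V) : V :=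
  if h : ∃ i, c i = u then c (h.choose + 1) else u

/-- The vertices adjacent to the successors of two different vertices of the outer boundary. -/
def linkSet {V : Type*} (G : SimpleGraph V) (c : ℕ → V) (D : Set V) : Set V :=
  {w | w ∉ D ∧ w ∉ outerBoundary G D ∧ ∃ u ∈ outerBoundary G D, ∃ v ∈ outerBoundary G D,
    u ≠ v ∧ G.Adj w (nextOn c u) ∧ G.Adj w (nextOn c v)}

/-- The vertices in none of `D`, its outer boundary and the link set. -/
def restSet {V : Type*} (G : SimpleGraph V) (c : ℕ → V) (D : Set V) : Set V :=
  {x | x ∉ D ∧ x ∉ outerBoundary G D ∧ x ∉ linkSet G c D}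

/-- The stretch of `n` consecutive vertices of `c` starting at `c i`. -/
def stretch {V : Type*} (c : ℕ → V) (i n : ℕ) : List V := (List.range' i n).map c

theorem stretch_succ {V : Type*} (c : ℕ → V) (i n : ℕ) :
    stretch c i (n + 1) = c i :: stretch c (i + 1) n := by
  simp [stretch, List.range'_succ]

theorem stretch_add {V : Type*} (c : ℕ → V) (i m n : ℕ) :
    stretch c i (m + n) = stretch c i m ++ stretch c (i + m) n := by
  rw [stretch, stretch, stretch, ← List.map_append, List.range'_append_1]

theorem length_stretch {V : Type*} (c : ℕ → V) (i n : ℕ) : (stretch c i n).length = n := by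
  simp [stretch]

theorem mem_stretch {V : Type*} {c : ℕ → V} {i n : ℕ} {x : V} :
    x ∈ stretch c i n ↔ ∃ j, i ≤ j ∧ j < i + n ∧ c j = x := by
  simp [stretch, List.mem_range'_1, and_assoc]

theorem head?_stretch {V : Type*} (c : ℕ → V) (i : ℕ) {n : ℕ} (hn : 0 < n) :
    (stretch c i n).head? = some (c i) := by
  obtain ⟨n, rfl⟩ : ∃ m, n = m + 1 := ⟨n - 1, by omega⟩
  simp [stretch_succ]

theorem getLast?_stretch {V : Type*} (c : ℕ → V) {i n j : ℕ} (hn : 0 < n) (hj : i + n = j + 1) :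
    (stretch c i n).getLast? = some (c j) := by
  obtain ⟨n, rfl⟩ : ∃ m, n = m + 1 := ⟨n - 1, by omega⟩
  obtain rfl : i + n = j := by omega
  rw [stretch_add]
  simp [stretch]

namespace IsObstruction

variable {V : Type*} {G : SimpleGraph V} {N : ℕ} {c : ℕ → V} {D : Set V}

theorem apply_mod (H : IsObstruction G N c D) (i : ℕ) : c (i % N) = c i :=
  (show Function.Periodic c N from H.periodic).map_mod_nat i

theorem apply_eq_iff (H : IsObstruction G N c D) {i j : ℕ} : c i = c j ↔ i % N = j % N := by
  have h3 := H.three_le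
  constructor
  · intro h
    rw [← H.apply_mod i, ← H.apply_mod j] at h
    exact H.inj _ _ (Nat.mod_lt _ (by omega)) (Nat.mod_lt _ (by omega)) h
  · intro h
    rw [← H.apply_mod i, h, H.apply_mod j]

theorem apply_ne (H : IsObstruction G N c D) {i j : ℕ} (hij : i < j) (hj : j < i + N) :
    c i ≠ c j := by
  intro h
  rw [H.apply_eq_iff] at h
  have h1 : N ∣ j - i := (Nat.modEq_iff_dvd' hij.le).1 h
  have := Nat.le_of_dvd (by omega) h1
  omega

theorem exists_index (H : IsObstruction G N c D) (a i : ℕ) :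
    ∃ j, a ≤ j ∧ j < a + N ∧ c j = c i := by
  have h3 := H.three_le
  refine ⟨a + (i + (N - 1) * a) % N, by omega, ?_, ?_⟩
  · have := Nat.mod_lt (i + (N - 1) * a) (show 0 < N by omega)
    omega
  · rw [H.apply_eq_iff, Nat.add_mod_mod]
    have : a + (i + (N - 1) * a) = i + N * a := by
      obtain ⟨n, rfl⟩ : ∃ n, N = n + 1 := ⟨N - 1, by omega⟩
      rw [Nat.add_sub_cancel]
      ring
    rw [this, Nat.add_mul_mod_self_left]

theorem nextOn_apply (H : IsObstruction G N c D) (i : ℕ) : nextOn c (c i) = c (i + 1) := by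
  have h : ∃ j, c j = c i := ⟨i, rfl⟩
  rw [nextOn, dif_pos h, H.apply_eq_iff, Nat.add_mod, H.apply_eq_iff.1 h.choose_spec,
    ← Nat.add_mod]

theorem stretch_nodup (H : IsObstruction G N c D) (i : ℕ) {n : ℕ} (hn : n ≤ N) :
    (stretch c i n).Nodup := by
  refine List.Nodup.map_on ?_ List.nodup_range'
  intro a ha b hb hab
  rw [List.mem_range'_1] at ha hb
  rcases lt_trichotomy a b with h | h | h
  · exact (H.apply_ne h (by omega) hab).elim
  · exact h
  · exact (H.apply_ne h (by omega) hab.symm).elim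

theorem stretch_isChain (H : IsObstruction G N c D) (i n : ℕ) :
    (stretch c i n).IsChain G.Adj := by
  induction n generalizing i with
  | zero => simp [stretch]
  | succ n ih =>
    cases n with
    | zero => simp [stretch]
    | succ n =>
      have := ih (i + 1)
      rw [stretch_succ] at this
      rw [stretch_succ, stretch_succ]
      exact List.IsChain.cons_cons (H.adj i) this

theorem not_mem_boundary_succ (H : IsObstruction G N c D) {i : ℕ}
    (hi : c i ∈ outerBoundary G D) : c (i + 1) ∉ outerBoundary G D := by
  intro h
  have h3 := H.three_le
  refine H.not_closable (stretch c (i + 1) N) _ _ (H.stretch_nodup _ le_rfl)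
    (H.stretch_isChain _ _) ?_ (length_stretch ..).ge (head?_stretch c _ (by omega))
    (getLast?_stretch c (j := i + N) (by omega) (by omega)) h ?_
  · intro x hx
    obtain ⟨j, -, -, rfl⟩ := mem_stretch.1 hx
    exact H.notMem j
  · rwa [H.periodic]

theorem not_adj_succ_of_lt (H : IsObstruction G N c D) {a b : ℕ} (hab : a < b)
    (hb : b < a + N) (ha : c a ∈ outerBoundary G D) (hbS : c b ∈ outerBoundary G D) :
    ¬G.Adj (c (a + 1)) (c (b + 1)) ∧
      ∀ w, w ∉ D → (∀ i, c i ≠ w) → ¬(G.Adj w (c (a + 1)) ∧ G.Adj w (c (b + 1))) := by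
  have hsplit : stretch c (a + 1) N =
      stretch c (a + 1) (b - a) ++ stretch c (b + 1) (a + N - b) := by
    have h := stretch_add c (a + 1) (b - a) (a + N - b)
    rwa [show b - a + (a + N - b) = N by omega, show a + 1 + (b - a) = b + 1 by omega] at h
  have hnodup := H.stretch_nodup (a + 1) le_rfl
  rw [hsplit, List.nodup_append] at hnodup
  obtain ⟨hn1, hn2, hdisj⟩ := hnodup
  have hD : ∀ i n, ∀ x ∈ stretch c i n, x ∉ D := by
    intro i n x hx
    obtain ⟨j, -, -, rfl⟩ := mem_stretch.1 hx
    exact H.notMem j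
  have hh1 := head?_stretch c (a + 1) (show 0 < b - a by omega)
  have hl1 := getLast?_stretch c (show 0 < b - a by omega) (show a + 1 + (b - a) = b + 1 by omega)
  have hh2 := head?_stretch c (b + 1) (show 0 < a + N - b by omega)
  have hl2 := getLast?_stretch c (show 0 < a + N - b by omega)
    (show b + 1 + (a + N - b) = (a + N) + 1 by omega)
  rw [H.periodic] at hl2
  have hc1 := H.stretch_isChain (a + 1) (b - a)
  have hc2 : (stretch c (b + 1) (a + N - b)).reverse.IsChain G.Adj := by
    rw [List.isChain_reverse]
    exact (H.stretch_isChain (b + 1) (a + N - b)).imp fun _ _ h => h.symm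
  have hne1 : stretch c (a + 1) (b - a) ≠ [] := by
    intro h; rw [h] at hh1; simp at hh1
  have hne2 : (stretch c (b + 1) (a + N - b)).reverse ≠ [] := by
    rw [Ne, List.reverse_eq_nil_iff]; intro h; rw [h] at hh2; simp at hh2
  have hlen1 := length_stretch c (a + 1) (b - a)
  have hlen2 := length_stretch c (b + 1) (a + N - b)
  constructor
  · intro hadj
    refine H.not_closable ((stretch c (b + 1) (a + N - b)).reverse ++ stretch c (a + 1) (b - a))
      (c a) (c b) ?_ ?_ ?_ ?_ ?_ ?_ ha hbS
    · rw [List.nodup_append]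
      exact ⟨List.nodup_reverse.2 hn2, hn1, fun x hx y hy h =>
        hdisj y hy x (List.mem_reverse.1 hx) h.symm⟩
    · refine hc2.append hc1 ?_
      simp only [List.getLast?_reverse, hh2, hh1, Option.mem_def, Option.some_inj]
      rintro x rfl y rfl
      exact hadj.symm
    · intro x hx
      rw [List.mem_append, List.mem_reverse] at hx
      exact hx.elim (hD _ _ x) (hD _ _ x)
    · rw [List.length_append, List.length_reverse]; omega
    · rw [List.head?_append_of_ne_nil _ hne2, List.head?_reverse, hl2]
    · rw [List.getLast?_append_of_ne_nil _ hne1, hl1]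
  · rintro w hw hwc ⟨hwa, hwb⟩
    refine H.not_closable ((stretch c (b + 1) (a + N - b)).reverse ++
      (w :: stretch c (a + 1) (b - a))) (c a) (c b) ?_ ?_ ?_ ?_ ?_ ?_ ha hbS
    · rw [List.nodup_append, List.nodup_cons]
      refine ⟨List.nodup_reverse.2 hn2, ⟨?_, hn1⟩, ?_⟩
      · intro h
        obtain ⟨j, -, -, h⟩ := mem_stretch.1 h
        exact hwc j h
      · intro x hx y hy h
        rw [List.mem_reverse] at hx
        rcases List.mem_cons.1 hy with rfl | hy
        · obtain ⟨j, -, -, h'⟩ := mem_stretch.1 hx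
          exact hwc j (h'.trans h)
        · exact hdisj y hy x hx h.symm
    · refine hc2.append (List.isChain_cons.2 ⟨?_, hc1⟩) ?_
      · simp only [hh1, Option.mem_def, Option.some_inj]
        rintro x rfl
        exact hwa
      · simp only [List.getLast?_reverse, hh2, List.head?_cons, Option.mem_def, Option.some_inj]
        rintro x rfl y rfl
        exact hwb.symm
    · intro x hx
      rw [List.mem_append, List.mem_reverse, List.mem_cons] at hx
      rcases hx with hx | rfl | hx
      · exact hD _ _ x hx
      · exact hw
      · exact hD _ _ x hx
    · rw [List.length_append, List.length_reverse, List.length_cons]; omega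
    · rw [List.head?_append_of_ne_nil _ hne2, List.head?_reverse, hl2]
    · rw [List.getLast?_append_of_ne_nil _ (by simp), List.getLast?_cons, hl1]
      rfl

theorem exists_lt_of_ne (H : IsObstruction G N c D) {u v : V} (hu : u ∈ outerBoundary G D)
    (hv : v ∈ outerBoundary G D) (huv : u ≠ v) :
    ∃ a b, a < b ∧ b < a + N ∧ c a = u ∧ c b = v := by
  obtain ⟨a, rfl⟩ := H.cover u hu
  obtain ⟨i, rfl⟩ := H.cover v hv
  obtain ⟨b, hab, hb, hbi⟩ := H.exists_index a i
  refine ⟨a, b, lt_of_le_of_ne hab ?_, hb, rfl, hbi⟩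
  rintro rfl
  exact huv hbi

theorem not_adj_nextOn (H : IsObstruction G N c D) {u v : V} (hu : u ∈ outerBoundary G D)
    (hv : v ∈ outerBoundary G D) : ¬G.Adj (nextOn c u) (nextOn c v) := by
  by_cases huv : u = v
  · subst huv
    exact G.loopless.irrefl _
  obtain ⟨a, b, hab, hb, rfl, rfl⟩ := H.exists_lt_of_ne hu hv huv
  rw [H.nextOn_apply, H.nextOn_apply]
  exact (H.not_adj_succ_of_lt hab hb hu hv).1

theorem exists_index_of_mem_linkSet (H : IsObstruction G N c D) {w : V}
    (hw : w ∈ linkSet G c D) : ∃ i, c i = w := by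
  by_contra! h
  obtain ⟨hwD, -, u, hu, v, hv, huv, h1, h2⟩ := hw
  obtain ⟨a, b, hab, hb, rfl, rfl⟩ := H.exists_lt_of_ne hu hv huv
  rw [H.nextOn_apply] at h1 h2
  exact (H.not_adj_succ_of_lt hab hb hu hv).2 w hwD h ⟨h1, h2⟩

theorem nextOn_mem_restSet (H : IsObstruction G N c D) {u : V} (hu : u ∈ outerBoundary G D) :
    nextOn c u ∈ restSet G c D := by
  obtain ⟨i, rfl⟩ := H.cover u hu
  refine ⟨?_, ?_, ?_⟩
  · rw [H.nextOn_apply]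
    exact H.notMem _
  · rw [H.nextOn_apply]
    exact H.not_mem_boundary_succ hu
  · rintro ⟨-, -, v, hv, -, -, -, h, -⟩
    exact H.not_adj_nextOn hu hv h

theorem nextOn_injOn (H : IsObstruction G N c D) {u v : V} (hu : u ∈ outerBoundary G D)
    (hv : v ∈ outerBoundary G D) (h : nextOn c u = nextOn c v) : u = v := by
  by_contra huv
  have h3 := H.three_le
  obtain ⟨a, b, hab, hb, rfl, rfl⟩ := H.exists_lt_of_ne hu hv huv
  rw [H.nextOn_apply, H.nextOn_apply] at h
  exact H.apply_ne (show a + 1 < b + 1 by omega) (by omega) h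

theorem noP4On (H : IsObstruction G N c D) (hfree : P4P1Free G) :
    NoP4On G {x | x ∉ D ∧ x ∉ outerBoundary G D} := by
  obtain ⟨e, he⟩ := H.nonempty
  have key : ∀ x, x ∉ D ∧ x ∉ outerBoundary G D → ¬G.Adj e x := fun x hx h =>
    hx.2 ⟨hx.1, e, he, h.symm⟩
  intro x hx y hy z hz u hu hxy hyz hzu hxz hxu hyu
  exact hfree.not_isolated hxy hyz hzu hxz hxu hyu (key x hx) (key y hy) (key z hz) (key u hu)

theorem not_reachable_nextOn (H : IsObstruction G N c D) (hfree : P4P1Free G) {u v : V}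
    (hu : u ∈ outerBoundary G D) (hv : v ∈ outerBoundary G D) (huv : u ≠ v) :
    ¬(edgesWithin G (restSet G c D)).Reachable (nextOn c u) (nextOn c v) := by
  intro h
  have hP4 : NoP4On G (restSet G c D) := (H.noP4On hfree).mono fun x hx => ⟨hx.1, hx.2.1⟩
  obtain ⟨m, hm, h1, h2⟩ := hP4.common_neighbor h (fun h => huv (H.nextOn_injOn hu hv h))
    (H.not_adj_nextOn hu hv)
  exact hm.2.2 ⟨hm.1, hm.2.1, u, hu, v, hv, huv, h1.symm, h2⟩

/-- A vertex of the link set is complete or anticomplete to every component of the rest. -/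
theorem adj_of_reachable (H : IsObstruction G N c D) (hfree : P4P1Free G) {w x y : V}
    (hw : w ∈ linkSet G c D) (hwx : G.Adj w x)
    (hxy : (edgesWithin G (restSet G c D)).Reachable x y) : G.Adj w y := by
  obtain ⟨hwD, hwS, u, hu, v, hv, huv, h1, h2⟩ := hw
  obtain ⟨s, hs, hws, hxs⟩ : ∃ s ∈ outerBoundary G D, G.Adj w (nextOn c s) ∧
      ¬(edgesWithin G (restSet G c D)).Reachable x (nextOn c s) := by
    by_cases h : (edgesWithin G (restSet G c D)).Reachable x (nextOn c u)
    · exact ⟨v, hv, h2, fun h' => H.not_reachable_nextOn hfree hu hv huv (h.symm.trans h')⟩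
    · exact ⟨u, hu, h1, h⟩
  have hsB := H.nextOn_mem_restSet hs
  refine (edgesWithin_reachable_induction (p := fun y =>
    (edgesWithin G (restSet G c D)).Reachable x y ∧ G.Adj w y) hxy ⟨.refl _, hwx⟩ ?_).2
  rintro a b hab ha hb ⟨hxa, hwa⟩
  have hxb := hxa.trans (edgesWithin_adj_reachable hab ha hb)
  refine ⟨hxb, ?_⟩
  by_contra hwb
  exact H.noP4On hfree (nextOn c s) ⟨hsB.1, hsB.2.1⟩ w ⟨hwD, hwS⟩ a ⟨ha.1, ha.2.1⟩ b
    ⟨hb.1, hb.2.1⟩ hws.symm hwa hab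
    (fun h => hxs (hxa.trans (edgesWithin_adj_reachable h.symm ha hsB)))
    (fun h => hxs (hxb.trans (edgesWithin_adj_reachable h.symm hb hsB))) hwb

/-- Toughness applied to a set containing the outer boundary, where `D` contributes one extra
component. -/
theorem mul_card_add_one_le (H : IsObstruction G N c D) [Fintype V] {t : ℝ} (ht : 0 ≤ t)
    (htough : Tough t G) {X I : Finset V} (hSX : ∀ x ∈ outerBoundary G D, x ∈ X)
    (hXD : ∀ x ∈ X, x ∉ D) (hI : ∀ x ∈ I, x ∉ X ∧ x ∉ D) (hne : I.Nonempty)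
    (hr : ∀ x ∈ I, ∀ y ∈ I, x ≠ y →
      ¬(edgesWithin G {z | z ∉ X ∧ z ∉ D}).Reachable x y) :
    t * (I.card + 1) ≤ X.card := by
  classical
  obtain ⟨e, he⟩ := H.nonempty
  have stay : ∀ x ∉ D, ∀ y, (edgesWithin G {z | z ∉ X}).Reachable x y →
      y ∉ D ∧ (edgesWithin G {z | z ∉ X ∧ z ∉ D}).Reachable x y := by
    intro x hx y hxy
    refine edgesWithin_reachable_induction (p := fun y => y ∉ D ∧
      (edgesWithin G {z | z ∉ X ∧ z ∉ D}).Reachable x y) hxy ⟨hx, .refl _⟩ ?_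
    rintro a b hab ha hb ⟨haD, hxa⟩
    have hbD : b ∉ D := fun h => ha (hSX a ⟨haD, b, h, hab⟩)
    exact ⟨hbD, hxa.trans (edgesWithin_adj_reachable hab ⟨ha, haD⟩ ⟨hb, hbD⟩)⟩
  have heI : e ∉ I := fun h => (hI e h).2 he
  have h := htough.mul_card_le ht (X := X) (I := insert e I) ?_ ?_ ?_
  · rw [Finset.card_insert_of_notMem heI] at h
    exact_mod_cast h
  · intro x hx
    rcases Finset.mem_insert.1 hx with rfl | hx
    · exact fun h => hXD x h he
    · exact (hI x hx).1
  · intro x hx y hy hxy hreach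
    rcases Finset.mem_insert.1 hx with hx | hx <;> rcases Finset.mem_insert.1 hy with hy | hy
    · exact hxy (hx.trans hy.symm)
    · exact (stay y (hI y hy).2 x hreach.symm).1 (hx ▸ he)
    · exact (stay x (hI x hx).2 y hreach).1 (hy ▸ he)
    · exact hr x hx y hy hxy (stay x (hI x hx).2 y hreach).2
  · rw [Finset.card_insert_of_notMem heI]
    have := hne.card_pos
    omega

end IsObstruction

theorem exchange_isChain {α : Type*} {R : α → α → Prop} (hsymm : ∀ x y, R x y → R y x)
    {L M Z : List α} (hZ : Z ≠ [])
    (h : (L ++ (M ++ Z)).IsChain R) {x y : α} (hx : L.head? = some x) (hy : Z.getLast? = some y)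
    (hxZ : ∀ z ∈ Z.head?, R x z) (hyM : ∀ z ∈ M.head?, R y z) :
    (L.reverse ++ (Z ++ M)).IsChain R := by
  rw [List.isChain_append, List.isChain_append] at h
  refine List.IsChain.append ?_ (h.2.1.2.1.append h.2.1.1 ?_) ?_
  · rw [List.isChain_reverse]
    exact h.1.imp fun _ _ h => hsymm _ _ h
  · rw [hy]
    rintro _ ⟨⟩ z hz
    exact hyM z hz
  · rw [List.getLast?_reverse, hx, List.head?_append_of_ne_nil _ hZ]
    rintro _ ⟨⟩ z hz
    exact hxZ z hz

/-- `u` directly followed by `u'` occurs in `O` before `v` directly followed by `v'`. -/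
def OccursBefore {α : Type*} (O : List α) (u u' v v' : α) : Prop :=
  ∃ X Y Z, O = (X ++ [u]) ++ ((u' :: (Y ++ [v])) ++ (v' :: Z))

theorem occursBefore_or {α : Type*} {O X Y X' Y' : List α} {u u' v v' : α}
    (hu : O = X ++ u :: u' :: Y) (hv : O = X' ++ v :: v' :: Y') (huv : u ≠ v) (hu'v : u' ≠ v)
    (hv'u : v' ≠ u) : OccursBefore O u u' v v' ∨ OccursBefore O v v' u u' := by
  rcases List.append_eq_append_iff.1 (hu.symm.trans hv) with ⟨as, h1, h2⟩ | ⟨as, h1, h2⟩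
  · rcases as with _ | ⟨a, _ | ⟨b, as⟩⟩
    · simp [huv] at h2
    · simp [hu'v] at h2
    · simp only [List.cons_append, List.cons.injEq] at h2
      obtain ⟨rfl, rfl, rfl⟩ := h2
      exact Or.inl ⟨X, as, Y', by simp [hu]⟩
  · rcases as with _ | ⟨a, _ | ⟨b, as⟩⟩
    · simp [huv.symm] at h2
    · simp [hv'u] at h2
    · simp only [List.cons_append, List.cons.injEq] at h2
      obtain ⟨rfl, rfl, rfl⟩ := h2
      exact Or.inr ⟨X', as, Y, by simp [hv]⟩

namespace IsObstruction

variable {V : Type*} {G : SimpleGraph V} {N : ℕ} {c : ℕ → V} {D : Set V}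

theorem not_occursBefore (H : IsObstruction G N c D) {O : List V} (hO : O.Nodup)
    (hchain : O.IsChain G.Adj) (hOD : ∀ x ∈ O, x ∉ D) (hlen : N ≤ O.length) {v v' : V}
    (hhead : O.head? = some v') (hlast : O.getLast? = some v) {a b : V}
    (ha : a ∈ outerBoundary G D) (hb : b ∈ outerBoundary G D) (hva : G.Adj v (nextOn c a))
    (hvb : G.Adj v' (nextOn c b)) : ¬OccursBefore O a (nextOn c a) b (nextOn c b) := by
  rintro ⟨X, Y, Z, rfl⟩
  rw [List.head?_append_of_ne_nil _ (by simp)] at hhead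
  rw [List.getLast?_append_of_ne_nil _ (by simp),
    List.getLast?_append_of_ne_nil _ (by simp)] at hlast
  have hperm : ((X ++ [a]).reverse ++ ((nextOn c b :: Z) ++ (nextOn c a :: (Y ++ [b])))).Perm
      ((X ++ [a]) ++ ((nextOn c a :: (Y ++ [b])) ++ (nextOn c b :: Z))) :=
    (List.reverse_perm _).append List.perm_append_comm
  refine H.not_closable _ a b (hperm.nodup_iff.2 hO)
    (exchange_isChain (fun _ _ h => h.symm) (by simp) hchain hhead hlast ?_ ?_)
    (fun x hx => hOD x (hperm.mem_iff.1 hx)) (hperm.length_eq ▸ hlen) ?_ ?_ ha hb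
  · simpa using hvb
  · simpa using hva
  · simp
  · rw [List.getLast?_append_of_ne_nil _ (by simp), List.getLast?_append_of_ne_nil _ (by simp),
      ← List.cons_append, List.getLast?_append_of_ne_nil _ (by simp), List.getLast?_singleton]

theorem exists_occursBefore (H : IsObstruction G N c D) {O : List V}
    (hsucc : ∀ u ∈ outerBoundary G D, ∃ X Y, O = X ++ u :: nextOn c u :: Y) {v : V}
    (hv : v ∈ linkSet G c D) :
    ∃ a ∈ outerBoundary G D, ∃ b ∈ outerBoundary G D, G.Adj v (nextOn c a) ∧
      G.Adj v (nextOn c b) ∧ OccursBefore O a (nextOn c a) b (nextOn c b) := by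
  obtain ⟨-, -, a, ha, b, hb, hab, hva, hvb⟩ := hv
  obtain ⟨X, Y, h1⟩ := hsucc a ha
  obtain ⟨X', Y', h2⟩ := hsucc b hb
  rcases occursBefore_or h1 h2 hab (fun h => (H.nextOn_mem_restSet ha).2.1 (h ▸ hb))
    (fun h => (H.nextOn_mem_restSet hb).2.1 (h ▸ ha)) with h | h
  · exact ⟨a, ha, b, hb, hva, hvb, h⟩
  · exact ⟨b, hb, a, ha, hvb, hva, h⟩

/-- A long path whose ends lie in the link set cannot have adjacent ends, nor ends with a common
neighbour in the rest. -/
theorem false_of_linked_ends (H : IsObstruction G N c D) (hfree : P4P1Free G) {O : List V}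
    (hO : O.Nodup) (hchain : O.IsChain G.Adj) (hOD : ∀ x ∈ O, x ∉ D) (hlen : N ≤ O.length)
    (hsucc : ∀ u ∈ outerBoundary G D, ∃ X Y, O = X ++ u :: nextOn c u :: Y)
    {v v' : V} (hhead : O.head? = some v') (hlast : O.getLast? = some v)
    (hv : v ∈ linkSet G c D) (hv' : v' ∈ linkSet G c D)
    (hvv' : G.Adj v v' ∨ ∃ z ∈ restSet G c D, G.Adj v z ∧ G.Adj v' z) : False := by
  obtain ⟨a₁, ha₁, a₂, ha₂, hva₁, hva₂, ha⟩ := H.exists_occursBefore hsucc hv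
  obtain ⟨b₁, hb₁, b₂, hb₂, hvb₁, hvb₂, hb⟩ := H.exists_occursBefore hsucc hv'
  have hnb : ¬G.Adj v (nextOn c b₁) := fun h =>
    H.not_occursBefore hO hchain hOD hlen hhead hlast hb₁ hb₂ h hvb₂ hb
  have hna : ¬G.Adj v' (nextOn c a₂) := fun h =>
    H.not_occursBefore hO hchain hOD hlen hhead hlast ha₁ ha₂ hva₁ h ha
  have hqb := H.nextOn_mem_restSet hb₁
  have hqa := H.nextOn_mem_restSet ha₂
  have hP4 := H.noP4On hfree
  by_cases hadj : G.Adj v v'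
  · exact hP4 _ ⟨hqb.1, hqb.2.1⟩ v' ⟨hv'.1, hv'.2.1⟩ v ⟨hv.1, hv.2.1⟩ _ ⟨hqa.1, hqa.2.1⟩
      hvb₁.symm hadj.symm hva₂ (fun h => hnb h.symm) (H.not_adj_nextOn hb₁ ha₂) hna
  · obtain ⟨z, hz, hvz, hvz'⟩ := hvv'.resolve_left hadj
    refine hP4 _ ⟨hqb.1, hqb.2.1⟩ v' ⟨hv'.1, hv'.2.1⟩ z ⟨hz.1, hz.2.1⟩ v ⟨hv.1, hv.2.1⟩
      hvb₁.symm hvz' hvz.symm ?_ (fun h => hnb h.symm) (fun h => hadj h.symm)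
    exact fun h => hnb (H.adj_of_reachable hfree hv hvz
      (edgesWithin_adj_reachable h.symm hz hqb))

theorem exists_eq_append_stretch (H : IsObstruction G N c D) {i n j : ℕ} (hi : i ≤ j)
    (hj : j + 1 < i + n) :
    ∃ X Y, stretch c i n = X ++ c j :: nextOn c (c j) :: Y := by
  refine ⟨stretch c i (j - i), stretch c (j + 2) (n - (j - i) - 2), ?_⟩
  have h := stretch_add c i (j - i) (n - (j - i) - 2 + 1 + 1)
  rw [stretch_succ, stretch_succ, show i + (j - i) = j by omega] at h
  rw [H.nextOn_apply, ← h]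
  congr 1
  omega

theorem not_mem_linkSet_succ (H : IsObstruction G N c D) (hfree : P4P1Free G) {i : ℕ}
    (hi : c i ∈ linkSet G c D) : c (i + 1) ∉ linkSet G c D := by
  intro h
  have h3 := H.three_le
  refine H.false_of_linked_ends hfree (H.stretch_nodup (i + 1) le_rfl) (H.stretch_isChain _ _)
    ?_ (length_stretch ..).ge ?_ (head?_stretch c _ (by omega))
    (getLast?_stretch c (j := i + N) (by omega) (by omega)) ?_ h (Or.inl ?_)
  · intro x hx
    obtain ⟨j, -, -, rfl⟩ := mem_stretch.1 hx
    exact H.notMem j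
  · intro u hu
    obtain ⟨j, rfl⟩ := H.cover u hu
    obtain ⟨k, hk1, hk2, hk⟩ := H.exists_index (i + 1) j
    rw [← hk] at hu ⊢
    refine H.exists_eq_append_stretch hk1 ?_
    by_contra hlt
    obtain rfl : k = i + N := by omega
    rw [H.periodic] at hu
    exact hi.2.1 hu
  · rwa [H.periodic]
  · rw [H.periodic]
    exact H.adj i

end IsObstruction

/-- The indices `a < b` mark consecutive vertices of the outer boundary on the cycle, and no vertex
of the link set lies between them. -/
structure IsWhole {V : Type*} (G : SimpleGraph V) (N : ℕ) (c : ℕ → V) (D : Set V) (a b : ℕ) :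
    Prop where
  lt : a < b
  le : b ≤ N
  left : c a ∈ outerBoundary G D
  right : c b ∈ outerBoundary G D
  between : ∀ m, a < m → m < b → c m ∈ restSet G c D

theorem IsWhole.left_unique {V : Type*} {G : SimpleGraph V} {N : ℕ} {c : ℕ → V} {D : Set V}
    {a b a' b' i : ℕ} (h : IsWhole G N c D a b) (h' : IsWhole G N c D a' b') (ha : a < i)
    (hb : i < b) (ha' : a' < i) (hb' : i < b') : a = a' := by
  rcases lt_trichotomy a a' with hlt | heq | hlt
  · exact ((h.between a' hlt (by omega)).2.1 h'.left).elim
  · exact heq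
  · exact ((h'.between a hlt (by omega)).2.1 h.left).elim

/-- A set of vertices of the rest containing the ends of all stretches of the rest next to the
outer boundary, such that the cycle can be shortened between consecutive members. -/
structure IsMarking {V : Type*} (G : SimpleGraph V) (N : ℕ) (c : ℕ → V) (D : Set V)
    (Z : Finset V) : Prop where
  mem_rest : ∀ z ∈ Z, z ∈ restSet G c D
  succ_mem : ∀ i, c i ∈ outerBoundary G D → c (i + 1) ∈ Z
  pred_mem : ∀ i, c (i + 1) ∈ outerBoundary G D → c i ∈ restSet G c D → c i ∈ Z
  notMem : ∀ i j m, i < m → m < j → j < N → c i ∈ linkSet G c D → c j ∈ linkSet G c D →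
    (∀ l, i < l → l < j → c l ∈ restSet G c D) → c m ∉ Z
  adj : ∀ i j, 0 < i → i + 1 < j → j < N → c i ∈ Z → c j ∈ Z →
    (∀ m, i < m → m < j → c m ∈ restSet G c D ∧ c m ∉ Z) → G.Adj (c i) (c j)

namespace IsObstruction

variable {V : Type*} {G : SimpleGraph V} {N : ℕ} {c : ℕ → V} {D : Set V}

theorem succ_congr (H : IsObstruction G N c D) {i j : ℕ} (h : c i = c j) :
    c (i + 1) = c (j + 1) := by
  rw [← H.nextOn_apply, h, H.nextOn_apply]

theorem pred_congr (H : IsObstruction G N c D) {i j : ℕ} (h : c (i + 1) = c (j + 1)) :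
    c i = c j := by
  rw [H.apply_eq_iff] at h ⊢
  exact Nat.ModEq.add_right_cancel' 1 h

theorem exists_bridge (H : IsObstruction G N c D) (hfree : P4P1Free G) {a b : ℕ}
    (hab : IsWhole G N c D a b) (hne : a + 1 ≠ b - 1)
    (hadj : ¬G.Adj (c (a + 1)) (c (b - 1))) :
    ∃ m, a < m ∧ m < b ∧ G.Adj (c m) (c (a + 1)) ∧ G.Adj (c m) (c (b - 1)) := by
  have hlt := hab.lt
  have hle := hab.le
  have hb : a + 1 ≠ b := by
    rintro rfl
    exact H.not_mem_boundary_succ hab.left hab.right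
  let A : Set V := {x | ∃ m, a < m ∧ m < b ∧ c m = x}
  have hA : NoP4On G A := (H.noP4On hfree).mono (by
    rintro x ⟨m, h1, h2, rfl⟩
    exact ⟨(hab.between m h1 h2).1, (hab.between m h1 h2).2.1⟩)
  have hreach : (edgesWithin G A).Reachable (c (a + 1)) (c (b - 1)) := by
    refine edgesWithin_reachable_of_isChain (H.stretch_isChain (a + 1) (b - a - 1)) ?_
      (mem_stretch.2 ⟨a + 1, by omega, by omega, rfl⟩)
      (mem_stretch.2 ⟨b - 1, by omega, by omega, rfl⟩)
    intro x hx
    obtain ⟨m, h1, h2, h3⟩ := mem_stretch.1 hx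
    exact ⟨m, by omega, by omega, h3⟩
  obtain ⟨_, ⟨m, h1, h2, rfl⟩, h3, h4⟩ :=
    hA.common_neighbor hreach (H.apply_ne (by omega) (by omega)) hadj
  exact ⟨m, h1, h2, h3.symm, h4⟩

theorem exists_isMarking (H : IsObstruction G N c D) (hfree : P4P1Free G) {S : Finset V}
    (hS : ∀ x, x ∈ S ↔ x ∈ outerBoundary G D) :
    ∃ Z : Finset V, IsMarking G N c D Z ∧ Z.card ≤ 3 * S.card := by
  classical
  have h3 := H.three_le
  have hp : ∀ u, ∃ v, u ∈ S → ∃ i, c i = v ∧ c (i + 1) = u := by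
    intro u
    by_cases hu : u ∈ S
    · obtain ⟨i, rfl⟩ := H.cover u ((hS u).1 hu)
      obtain ⟨j, hj, -, hji⟩ := H.exists_index 1 i
      exact ⟨c (j - 1), fun _ => ⟨j - 1, rfl, by rw [show j - 1 + 1 = j by omega, hji]⟩⟩
    · exact ⟨u, fun h => (hu h).elim⟩
  have hy : ∀ u, ∃ v, u ∈ S → v = nextOn c u ∧
        (∀ a b, c a = u → IsWhole G N c D a b → a + 1 ≠ b - 1 →
          G.Adj (c (a + 1)) (c (b - 1))) ∨
      ∃ a b m, c a = u ∧ IsWhole G N c D a b ∧ a < m ∧ m < b ∧ c m = v ∧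
        G.Adj (c m) (c (a + 1)) ∧ G.Adj (c m) (c (b - 1)) := by
    intro u
    by_cases h : ∀ a b, c a = u → IsWhole G N c D a b → a + 1 ≠ b - 1 →
        G.Adj (c (a + 1)) (c (b - 1))
    · exact ⟨nextOn c u, fun _ => Or.inl ⟨rfl, h⟩⟩
    · push Not at h
      obtain ⟨a, b, hau, hab, hne, hadj⟩ := h
      obtain ⟨m, h1, h2, h3, h4⟩ := H.exists_bridge hfree hab hne hadj
      exact ⟨c m, fun _ => Or.inr ⟨a, b, m, hau, hab, h1, h2, rfl, h3, h4⟩⟩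
  choose p hp using hp
  choose y hy using hy
  let Z : Finset V := ((S.image (nextOn c) ∪ S.image p) ∪ S.image y).filter
    (· ∈ restSet G c D)
  have memZ : ∀ x, x ∈ Z ↔ ((x ∈ S.image (nextOn c) ∨ x ∈ S.image p) ∨ x ∈ S.image y) ∧
      x ∈ restSet G c D := fun x => by
    rw [Finset.mem_filter, Finset.mem_union, Finset.mem_union]
  have key : ∀ i, c (i + 1) ∈ Z → i + 1 < N → c i ∈ outerBoundary G D ∨
      c (i + 2) ∈ outerBoundary G D ∨ ∃ a b, IsWhole G N c D a b ∧ a < i + 1 ∧ i + 1 < b ∧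
        c (i + 1) = y (c a) ∧ G.Adj (c (i + 1)) (c (a + 1)) ∧ G.Adj (c (i + 1)) (c (b - 1)) := by
    intro i hi hiN
    have hnext : ∀ u ∈ S, nextOn c u = c (i + 1) → c i ∈ outerBoundary G D := by
      intro u hu h
      obtain ⟨j, rfl⟩ := H.cover u ((hS u).1 hu)
      rw [H.nextOn_apply] at h
      rw [← H.pred_congr h]
      exact (hS _).1 hu
    rcases ((memZ _).1 hi).1 with (h | h) | h
    · obtain ⟨u, hu, h⟩ := Finset.mem_image.1 h
      exact Or.inl (hnext u hu h)
    · obtain ⟨u, hu, h⟩ := Finset.mem_image.1 h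
      obtain ⟨j, hj, hju⟩ := hp u hu
      rw [← hj] at h
      have h' := H.succ_congr h
      rw [hju] at h'
      exact Or.inr (Or.inl (h' ▸ (hS u).1 hu))
    · obtain ⟨u, hu, h⟩ := Finset.mem_image.1 h
      rcases hy u hu with ⟨h1, -⟩ | ⟨a, b, m, rfl, hab, h1, h2, h4, h5, h6⟩
      · exact Or.inl (hnext u hu (h1.symm.trans h))
      · have hle := hab.le
        obtain rfl : m = i + 1 := H.inj _ _ (by omega) hiN (h4.trans h)
        exact Or.inr (Or.inr ⟨a, b, hab, h1, h2, h4, h5, h6⟩)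
  refine ⟨Z, ⟨fun z hz => ((memZ z).1 hz).2, ?_, ?_, ?_, ?_⟩, ?_⟩
  · intro i hi
    have h := H.nextOn_mem_restSet hi
    rw [memZ, ← H.nextOn_apply]
    exact ⟨Or.inl (Or.inl (Finset.mem_image_of_mem _ ((hS _).2 hi))), h⟩
  · intro i hi hir
    obtain ⟨j, hj, hji⟩ := hp _ ((hS _).2 hi)
    rw [memZ]
    refine ⟨Or.inl (Or.inr (Finset.mem_image.2 ⟨_, (hS _).2 hi, ?_⟩)), hir⟩
    rw [← hj, H.pred_congr hji]
  · intro i j m him hmj hjN hi hj hbet hmZ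
    obtain ⟨m, rfl⟩ : ∃ m', m = m' + 1 := ⟨m - 1, by omega⟩
    rcases key m hmZ (by omega) with h | h | ⟨a, b, hab, h1, h2, -⟩
    · rcases (show i ≤ m by omega).eq_or_lt with rfl | hlt
      · exact hi.2.1 h
      · exact (hbet m hlt (by omega)).2.1 h
    · rcases (show m + 2 ≤ j by omega).eq_or_lt with rfl | hlt
      · exact hj.2.1 h
      · exact (hbet (m + 2) (by omega) hlt).2.1 h
    · rcases lt_trichotomy a i with hlt | rfl | hlt
      · exact (hab.between i hlt (by omega)).2.2 hi
      · exact hi.2.1 hab.left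
      · exact (hbet a hlt (by omega)).2.1 hab.left
  · intro i j hi hij hjN hiZ hjZ hbet
    obtain ⟨i, rfl⟩ : ∃ i', i = i' + 1 := ⟨i - 1, by omega⟩
    obtain ⟨j, rfl⟩ : ∃ j', j = j' + 1 := ⟨j - 1, by omega⟩
    have hiR := ((memZ _).1 hiZ).2
    have hjR := ((memZ _).1 hjZ).2
    have hbet' : ∀ m, i < m → m < j + 2 → c m ∈ restSet G c D := by
      intro m h1 h2
      by_cases h : m = i + 1
      · exact h ▸ hiR
      by_cases h' : m = j + 1
      · exact h' ▸ hjR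
      exact (hbet m (by omega) (by omega)).1
    rcases key i hiZ (by omega) with h | h | ⟨a, b, hab, h1, h2, h4, h5, h6⟩
    · rcases key j hjZ hjN with h' | h' | ⟨a', b', hab', h1', h2', h4', h5', h6'⟩
      · exact ((hbet' j (by omega) (by omega)).2.1 h').elim
      · have hw : IsWhole G N c D i (j + 2) := ⟨by omega, by omega, h, h', hbet'⟩
        rcases hy _ ((hS _).2 h) with ⟨-, hadj⟩ | ⟨a, b, m, ha, hab, hm1, hm2, hm, hm3, hm4⟩
        · exact hadj i (j + 2) rfl hw (by omega)
        · have hle := hab.le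
          obtain rfl : a = i := H.inj _ _ (by omega) (by omega) ha
          have hb : b = j + 2 := by
            rcases lt_trichotomy b (j + 2) with hlt | heq | hlt
            · exact ((hbet' b hab.lt hlt).2.1 hab.right).elim
            · exact heq
            · exact ((hab.between (j + 2) (by omega) hlt).2.1 h').elim
          subst hb
          have hne1 : m ≠ a + 1 := by rintro rfl; exact G.loopless.irrefl _ hm3
          have hne2 : m ≠ j + 1 := by rintro rfl; exact G.loopless.irrefl _ hm4
          refine ((hbet m (by omega) (by omega)).2 ((memZ _).2 ⟨Or.inr ?_, ?_⟩)).elim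
          · exact Finset.mem_image.2 ⟨c a, (hS _).2 h, hm.symm⟩
          · exact hab.between m hm1 hm2
      · have ha' : a' = i := by
          rcases lt_trichotomy a' i with hlt | heq | hlt
          · exact ((hab'.between i hlt (by omega)).2.1 h).elim
          · exact heq
          · exact ((hbet' a' hlt (by omega)).2.1 hab'.left).elim
        subst ha'
        exact h5'.symm
    · exact ((hbet' (i + 2) (by omega) (by omega)).2.1 h).elim
    · have hbj : j + 1 < b := by
        by_contra hlt
        exact (hbet' b (by omega) (by omega)).2.1 hab.right
      rcases key j hjZ hjN with h' | h' | ⟨a', b', hab', h1', h2', h4', h5', h6'⟩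
      · exact ((hbet' j (by omega) (by omega)).2.1 h').elim
      · have hb : b = j + 2 := by
          by_contra hne
          exact (hab.between (j + 2) (by omega) (by omega)).2.1 h'
        subst hb
        exact h6
      · obtain rfl := hab.left_unique hab' (i := j + 1) (by omega) hbj h1' h2'
        exact (H.apply_ne (show i + 1 < j + 1 by omega) (by omega) (h4.trans h4'.symm)).elim
  · refine (Finset.card_filter_le _ _).trans ?_
    have h1 := Finset.card_union_le (S.image (nextOn c) ∪ S.image p) (S.image y)
    have h2 := Finset.card_union_le (S.image (nextOn c)) (S.image p)
    have h4 := Finset.card_image_le (s := S) (f := nextOn c)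
    have h5 := Finset.card_image_le (s := S) (f := p)
    have h6 := Finset.card_image_le (s := S) (f := y)
    omega

end IsObstruction

/-- The vertex `c i` of the link set is followed on the cycle, before index `N`, by another vertex
of the link set with only vertices of the rest in between. -/
def IsLinkGap {V : Type*} (G : SimpleGraph V) (N : ℕ) (c : ℕ → V) (D : Set V) (i : ℕ) : Prop :=
  c i ∈ linkSet G c D ∧ ∃ j, i < j ∧ j < N ∧ c j ∈ linkSet G c D ∧
    ∀ m, i < m → m < j → c m ∈ restSet G c D

open Classical in
/-- The indices at which a gap between two vertices of the link set starts. -/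
noncomputable def linkGaps {V : Type*} (G : SimpleGraph V) (N : ℕ) (c : ℕ → V) (D : Set V) :
    Finset ℕ :=
  (Finset.range N).filter (IsLinkGap G N c D)

theorem mem_linkGaps {V : Type*} {G : SimpleGraph V} {N : ℕ} {c : ℕ → V} {D : Set V} {i : ℕ} :
    i ∈ linkGaps G N c D ↔ IsLinkGap G N c D i := by
  classical
  rw [linkGaps, Finset.mem_filter, Finset.mem_range, and_iff_right_iff_imp]
  rintro ⟨-, j, h1, h2, -⟩
  omega

namespace IsObstruction

variable {V : Type*} {G : SimpleGraph V} {N : ℕ} {c : ℕ → V} {D : Set V}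

theorem apply_N_mem (H : IsObstruction G N c D) : c N ∈ outerBoundary G D := by
  have := H.periodic 0
  rw [Nat.zero_add] at this
  rw [this]
  exact H.zero_mem

theorem mem_of_notMem_restSet (H : IsObstruction G N c D) {i : ℕ} (h : c i ∉ restSet G c D) :
    c i ∈ outerBoundary G D ∨ c i ∈ linkSet G c D := by
  by_contra! h'
  exact h ⟨H.notMem i, h'.1, h'.2⟩

theorem exists_next_notMem_restSet (H : IsObstruction G N c D) {i : ℕ} (hi : i < N) :
    ∃ j, i < j ∧ j ≤ N ∧ c j ∉ restSet G c D ∧ ∀ m, i < m → m < j → c m ∈ restSet G c D := by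
  classical
  have hex : ∃ j, i < j ∧ j ≤ N ∧ c j ∉ restSet G c D :=
    ⟨N, hi, le_rfl, fun h => h.2.1 H.apply_N_mem⟩
  obtain ⟨h1, h2, h3⟩ := Nat.find_spec hex
  refine ⟨Nat.find hex, h1, h2, h3, fun m hm hm' => ?_⟩
  by_contra hmB
  exact Nat.find_min hex hm' ⟨hm, by omega, hmB⟩

theorem card_linkSet_le (H : IsObstruction G N c D) {S W : Finset V}
    (hS : ∀ x, x ∈ S ↔ x ∈ outerBoundary G D) (hW : ∀ x, x ∈ W ↔ x ∈ linkSet G c D) :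
    W.card ≤ (linkGaps G N c D).card + S.card := by
  classical
  have h3 := H.three_le
  let J : Finset ℕ := (Finset.range N).filter (fun i => c i ∈ linkSet G c D)
  have memJ : ∀ i, i ∈ J ↔ i < N ∧ c i ∈ linkSet G c D := fun i => by
    rw [Finset.mem_filter, Finset.mem_range]
  have hWJ : W ⊆ J.image c := by
    intro w hw
    obtain ⟨i, rfl⟩ := H.exists_index_of_mem_linkSet ((hW w).1 hw)
    refine Finset.mem_image.2 ⟨i % N, (memJ _).2 ⟨Nat.mod_lt _ (by omega), ?_⟩, H.apply_mod i⟩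
    rw [H.apply_mod]
    exact (hW _).1 hw
  have hnext : ∀ i, ∃ j, i < N → i < j ∧ j ≤ N ∧ c j ∉ restSet G c D ∧
      ∀ m, i < m → m < j → c m ∈ restSet G c D := fun i => by
    by_cases hi : i < N
    · obtain ⟨j, hj⟩ := H.exists_next_notMem_restSet hi
      exact ⟨j, fun _ => hj⟩
    · exact ⟨0, fun h => (hi h).elim⟩
  choose s hs using hnext
  have hJ : (J \ linkGaps G N c D).card ≤ S.card := by
    refine Finset.card_le_card_of_injOn (fun i => c (s i)) ?_ ?_
    · intro i hi
      obtain ⟨hiJ, hiG⟩ := Finset.mem_sdiff.1 (Finset.mem_coe.1 hi)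
      obtain ⟨hiN, hiW⟩ := (memJ i).1 hiJ
      obtain ⟨h1, h2, h4, h5⟩ := hs i hiN
      refine Finset.mem_coe.2 ((hS _).2 ((H.mem_of_notMem_restSet h4).resolve_right ?_))
      intro hjW
      refine hiG (mem_linkGaps.2 ⟨hiW, s i, h1, lt_of_le_of_ne h2 ?_, hjW, h5⟩)
      intro h
      rw [h] at hjW
      exact hjW.2.1 H.apply_N_mem
    · have key : ∀ i ∈ J, ∀ j ∈ J, c (s i) = c (s j) → ¬i < j := by
        intro i hi j hj hij hlt
        obtain ⟨hiN, -⟩ := (memJ i).1 hi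
        obtain ⟨hjN, hjW⟩ := (memJ j).1 hj
        obtain ⟨h1, h2, -, h5⟩ := hs i hiN
        obtain ⟨h1', h2', -, -⟩ := hs j hjN
        have : s i = s j := by
          rcases lt_trichotomy (s i) (s j) with h | h | h
          · exact (H.apply_ne h (by omega) hij).elim
          · exact h
          · exact (H.apply_ne h (by omega) hij.symm).elim
        exact (h5 j hlt (by omega)).2.2 hjW
      intro i hi j hj hij
      have hi := (Finset.mem_sdiff.1 (Finset.mem_coe.1 hi)).1
      have hj := (Finset.mem_sdiff.1 (Finset.mem_coe.1 hj)).1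
      have h1 := key i hi j hj hij
      have h2 := key j hj i hi hij.symm
      omega
  have h1 := Finset.card_le_card hWJ
  have h2 : (J.image c).card ≤ J.card := Finset.card_image_le
  have h4 := Finset.card_le_card_sdiff_add_card (s := J) (t := linkGaps G N c D)
  omega

theorem exists_isPathCover_lt [Fintype V] (H : IsObstruction G N c D) (hfree : P4P1Free G) {t : ℝ}
    (ht : 4.5 ≤ t) (htough : Tough t G) {S Z : Finset V}
    (hS : ∀ x, x ∈ S ↔ x ∈ outerBoundary G D) (hZ : IsMarking G N c D Z)
    (hcard : Z.card ≤ 3 * S.card) :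
    ∃ (A : Finset V) (Ps : List (List V)), (∀ x, x ∈ A ↔ x ∈ restSet G c D ∧ x ∉ Z) ∧
      IsPathCover G A Ps ∧ Ps.length < (linkGaps G N c D).card := by
  classical
  have ht0 : 0 ≤ t := by linarith
  let W : Finset V := Finset.univ.filter (· ∈ linkSet G c D)
  have hW : ∀ x, x ∈ W ↔ x ∈ linkSet G c D := by simp [W]
  let A : Finset V := Finset.univ.filter (fun x => x ∈ restSet G c D ∧ x ∉ Z)
  have hA : ∀ x, x ∈ A ↔ x ∈ restSet G c D ∧ x ∉ Z := by simp [A]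
  have hWS := H.card_linkSet_le hS hW
  have hSpos : 0 < S.card := Finset.card_pos.2 ⟨c 0, (hS _).2 H.zero_mem⟩
  have hfirst : t * (S.card + 1) ≤ S.card + W.card := by
    have h := H.mul_card_add_one_le ht0 htough (X := S ∪ W) (I := S.image (nextOn c)) ?_ ?_ ?_
      ?_ ?_
    · rw [Finset.card_image_of_injOn] at h
      · have h' : ((S ∪ W).card : ℝ) ≤ S.card + W.card := by
          exact_mod_cast Finset.card_union_le S W
        exact h.trans h'
      · intro u hu v hv huv
        exact H.nextOn_injOn ((hS _).1 hu) ((hS _).1 hv) huv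
    · exact fun x hx => Finset.mem_union_left _ ((hS x).2 hx)
    · intro x hx
      rcases Finset.mem_union.1 hx with hx | hx
      · exact ((hS x).1 hx).1
      · exact ((hW x).1 hx).1
    · intro x hx
      obtain ⟨u, hu, rfl⟩ := Finset.mem_image.1 hx
      have h := H.nextOn_mem_restSet ((hS u).1 hu)
      rw [Finset.mem_union, hS, hW]
      exact ⟨fun h' => h'.elim h.2.1 h.2.2, h.1⟩
    · exact (Finset.card_pos.1 hSpos).image _
    · intro x hx y hy hxy
      obtain ⟨u, hu, rfl⟩ := Finset.mem_image.1 hx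
      obtain ⟨v, hv, rfl⟩ := Finset.mem_image.1 hy
      intro h
      refine H.not_reachable_nextOn hfree ((hS u).1 hu) ((hS v).1 hv)
        (fun huv => hxy (by rw [huv])) (edgesWithin_reachable_mono ?_ h)
      rintro z ⟨hz, hzD⟩
      rw [Finset.mem_union, hS, hW, not_or] at hz
      exact ⟨hzD, hz.1, hz.2⟩
  have hP4 : NoP4On G (A : Set V) := (H.noP4On hfree).mono fun x hx =>
    have hx := (hA x).1 hx
    ⟨hx.1.1, hx.1.2.1⟩
  obtain ⟨Ps, T, I, hPs, hTA, hI, hr, hlen⟩ := hP4.hasTightPathCover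
  refine ⟨A, Ps, hA, hPs, ?_⟩
  have hgaps : (W.card : ℝ) ≤ (linkGaps G N c D).card + S.card := by exact_mod_cast hWS
  have hS1 : (1 : ℝ) ≤ S.card := by exact_mod_cast hSpos
  by_contra! hle
  have hle' : ((linkGaps G N c D).card : ℝ) ≤ Ps.length := by exact_mod_cast hle
  have hlen' : (Ps.length : ℝ) + T.card ≤ I.card := by exact_mod_cast hlen
  have hne : I.Nonempty := by
    rw [← Finset.card_pos]
    by_contra hI0
    have : Ps.length = 0 := by omega
    rw [this, Nat.cast_zero] at hle'
    nlinarith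
  have hsecond : t * (I.card + 1) ≤ S.card + W.card + 3 * S.card + T.card := by
    have h := H.mul_card_add_one_le ht0 htough (X := ((S ∪ W) ∪ Z) ∪ T) (I := I) ?_ ?_ ?_ hne ?_
    · have h1 := Finset.card_union_le ((S ∪ W) ∪ Z) T
      have h2 := Finset.card_union_le (S ∪ W) Z
      have h3 := Finset.card_union_le S W
      refine h.trans ?_
      exact_mod_cast (by omega : (((S ∪ W) ∪ Z) ∪ T).card ≤
        S.card + W.card + 3 * S.card + T.card)
    · exact fun x hx => by simp [(hS x).2 hx]
    · intro x hx
      simp only [Finset.mem_union] at hx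
      rcases hx with ((hx | hx) | hx) | hx
      · exact ((hS x).1 hx).1
      · exact ((hW x).1 hx).1
      · exact (hZ.mem_rest x hx).1
      · exact ((hA x).1 (hTA hx)).1.1
    · intro x hx
      obtain ⟨hxA, hxT⟩ := hI x hx
      obtain ⟨hxB, hxZ⟩ := (hA x).1 hxA
      refine ⟨?_, hxB.1⟩
      simp only [Finset.mem_union, hS, hW]
      rintro (((h | h) | h) | h)
      · exact hxB.2.1 h
      · exact hxB.2.2 h
      · exact hxZ h
      · exact hxT h
    · intro x hx y hy hxy h
      refine hr x hx y hy hxy (edgesWithin_reachable_mono ?_ h)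
      rintro z ⟨hz, hzD⟩
      simp only [Finset.mem_union, hS, hW, not_or] at hz
      exact ⟨(hA z).2 ⟨⟨hzD, hz.1.1.1, hz.1.1.2⟩, hz.1.2⟩, hz.2⟩
  have hT0 : (0 : ℝ) ≤ T.card := by positivity
  have ht' : 0 ≤ t - 4.5 := by linarith
  have h1 : (t - 1) * T.card ≥ 0 := by nlinarith
  have h2 : t * (W.card - S.card + 1) ≤ 4 * S.card + W.card := by nlinarith
  nlinarith [mul_nonneg ht' (by linarith : (0:ℝ) ≤ S.card)]

end IsObstruction

namespace IsObstruction

variable {V : Type*} {G : SimpleGraph V} {N : ℕ} {c : ℕ → V} {D : Set V}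

theorem exists_of_isLinkGap (H : IsObstruction G N c D) (hfree : P4P1Free G) {i : ℕ}
    (hi : IsLinkGap G N c D i) : ∃ j, i + 1 < j ∧ j < N ∧ c j ∈ linkSet G c D ∧
      ∀ m, i < m → m < j → c m ∈ restSet G c D := by
  obtain ⟨hiW, j, h1, h2, h3, h4⟩ := hi
  refine ⟨j, lt_of_le_of_ne h1 ?_, h2, h3, h4⟩
  rintro rfl
  exact H.not_mem_linkSet_succ hfree hiW h3

theorem succ_mem_of_isLinkGap (H : IsObstruction G N c D) (hfree : P4P1Free G) {Z : Finset V}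
    (hZ : IsMarking G N c D Z) {i : ℕ} (hi : IsLinkGap G N c D i) :
    c (i + 1) ∈ restSet G c D ∧ c (i + 1) ∉ Z := by
  obtain ⟨j, h1, h2, h3, h4⟩ := H.exists_of_isLinkGap hfree hi
  exact ⟨h4 _ (by omega) h1, hZ.notMem i j _ (by omega) h1 h2 hi.1 h3 h4⟩

/-- Some component of the rest meets more gaps of the cycle than it needs paths to be covered. -/
theorem exists_component_paths (H : IsObstruction G N c D) (hfree : P4P1Free G) {Z A : Finset V}
    (hZ : IsMarking G N c D Z) (hA : ∀ x, x ∈ A ↔ x ∈ restSet G c D ∧ x ∉ Z)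
    {Ps : List (List V)} (hPs : IsPathCover G A Ps) (hlt : Ps.length < (linkGaps G N c D).card) :
    ∃ (e : ℕ) (Qs : List (List V)) (M : Finset ℕ), IsLinkGap G N c D e ∧ (∀ P ∈ Qs, P ≠ [] ∧ P.IsChain G.Adj) ∧ Qs.flatten.Nodup ∧
      (∀ x, x ∈ Qs.flatten ↔ (x ∈ restSet G c D ∧ x ∉ Z) ∧
        (edgesWithin G (restSet G c D)).Reachable (c (e + 1)) x) ∧
      (∀ i, i ∈ M ↔ IsLinkGap G N c D i ∧
        (edgesWithin G (restSet G c D)).Reachable (c (e + 1)) (c (i + 1))) ∧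
      Qs.length + 1 = M.card := by
  classical
  let κ := (edgesWithin G (restSet G c D)).connectedComponentMk
  have hκ : ∀ x y, κ x = κ y ↔ (edgesWithin G (restSet G c D)).Reachable x y := fun x y =>
    SimpleGraph.ConnectedComponent.eq
  obtain ⟨k, hk⟩ : ∃ k, ((Ps : Multiset (List V)).map fun P => P.head?.map κ).count k <
      ((linkGaps G N c D).val.map fun i => some (κ (c (i + 1)))).count k := by
    by_contra! h
    have := Multiset.card_le_card (Multiset.le_iff_count.2 h)
    rw [Multiset.card_map, Multiset.card_map, Multiset.coe_card, Finset.card_val] at this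
    omega
  obtain ⟨e, he, rfl⟩ := Multiset.mem_map.1 (Multiset.count_pos.1 (Nat.zero_lt_of_lt hk))
  have he : IsLinkGap G N c D e := mem_linkGaps.1 he
  rw [Multiset.count_map, Multiset.count_map, Multiset.filter_coe, Multiset.coe_card] at hk
  set Rs := Ps.filter (fun P => some (κ (c (e + 1))) = P.head?.map κ) with hRs
  have memRs : ∀ P, P ∈ Rs ↔ P ∈ Ps ∧ P.head?.map κ = some (κ (c (e + 1))) := fun P => by
    rw [hRs, List.mem_filter, decide_eq_true_iff, eq_comm (b := P.head?.map κ)]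
  have hRs' : ∀ P ∈ Rs, P ≠ [] ∧ P.IsChain G.Adj := fun P hP => hPs.isPath P ((memRs P).1 hP).1
  have hmem : ∀ x, x ∈ Rs.flatten ↔ (x ∈ restSet G c D ∧ x ∉ Z) ∧
      (edgesWithin G (restSet G c D)).Reachable (c (e + 1)) x := by
    have hhead : ∀ P ∈ Ps, ∀ x ∈ P, P.head?.map κ = some (κ x) := by
      intro P hP x hx
      cases P with
      | nil => simp at hx
      | cons y P =>
        rw [List.head?_cons, Option.map_some, Option.some_inj, hκ]
        refine edgesWithin_reachable_of_isChain (hPs.isPath _ hP).2 ?_ (by simp) hx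
        intro z hz
        exact ((hA z).1 ((hPs.mem_iff z).1 (List.mem_flatten.2 ⟨_, hP, hz⟩))).1
    intro x
    rw [← hA, ← hPs.mem_iff, List.mem_flatten, List.mem_flatten]
    constructor
    · rintro ⟨P, hP, hx⟩
      obtain ⟨hP, h⟩ := (memRs P).1 hP
      rw [hhead P hP x hx, Option.some_inj, eq_comm, hκ] at h
      exact ⟨⟨P, hP, hx⟩, h⟩
    · rintro ⟨⟨P, hP, hx⟩, h⟩
      refine ⟨P, (memRs P).2 ⟨hP, ?_⟩, hx⟩
      rw [hhead P hP x hx, Option.some_inj, eq_comm, hκ]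
      exact h
  have hnodup : Rs.flatten.Nodup := hPs.nodup.sublist List.filter_sublist.flatten
  let M : Finset ℕ := (linkGaps G N c D).filter fun i => some (κ (c (e + 1))) = some (κ (c (i + 1)))
  have hM : ∀ i, i ∈ M ↔ IsLinkGap G N c D i ∧
      (edgesWithin G (restSet G c D)).Reachable (c (e + 1)) (c (i + 1)) := fun i => by
    rw [Finset.mem_filter, mem_linkGaps, Option.some_inj, hκ]
  replace hk : Rs.length < M.card := hk
  have hle : M.card ≤ Rs.flatten.length := by
    rw [← List.toFinset_card_of_nodup hnodup]
    refine Finset.card_le_card_of_injOn (fun i => c (i + 1)) ?_ ?_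
    · intro i hi
      obtain ⟨hi, h⟩ := (hM i).1 (Finset.mem_coe.1 hi)
      rw [Finset.mem_coe, List.mem_toFinset, hmem]
      exact ⟨H.succ_mem_of_isLinkGap hfree hZ hi, h⟩
    · intro i hi j hj hij
      obtain ⟨a, hia, haN, -⟩ := ((hM i).1 (Finset.mem_coe.1 hi)).1.2
      obtain ⟨b, hjb, hbN, -⟩ := ((hM j).1 (Finset.mem_coe.1 hj)).1.2
      exact H.inj i j (by omega) (by omega) (H.pred_congr hij)
  obtain ⟨Qs, h1, h2, h3⟩ := exists_isChain_refinement hRs' (m := M.card - 1) (Nat.le_sub_one_of_lt hk)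
    (by omega)
  refine ⟨e, Qs, M, he, h3, h2 ▸ hnodup, h2 ▸ hmem, hM, ?_⟩
  omega

end IsObstruction

theorem isChain_filter_range' {R : ℕ → ℕ → Prop} {p : ℕ → Bool} {a n : ℕ}
    (h : ∀ i j, a ≤ i → i < j → j < a + n → p i → p j → (∀ m, i < m → m < j → ¬p m) → R i j) :
    ((List.range' a n).filter p).IsChain R := by
  induction n generalizing a with
  | zero => simp
  | succ n ih =>
    have ih' := ih (a := a + 1) fun i j hi hij hj => h i j (by omega) hij (by omega)
    rw [List.range'_succ, List.filter_cons]
    split_ifs with hpa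
    · refine List.isChain_cons.2 ⟨fun j hj => ?_, ih'⟩
      rw [List.head?_filter, Option.mem_def, List.find?_range'_eq_some] at hj
      obtain ⟨hpj, hj, hm⟩ := hj
      rw [List.mem_range'_1] at hj
      refine h a j le_rfl (by omega) (by omega) hpa hpj fun m h1 h2 => ?_
      simpa using hm m (by omega) h2
    · exact ih'

theorem isChain_flatMap_cons {α β : Type*} {R : β → β → Prop} {f : α → β} {g : α → List β}
    {l : List α} (h₁ : ∀ a ∈ l, (f a :: g a).IsChain R)
    (h₂ : l.IsChain fun a b => ∀ x ∈ (f a :: g a).getLast?, R x (f b)) :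
    (l.flatMap fun a => f a :: g a).IsChain R := by
  induction l with
  | nil => simp
  | cons a l ih =>
    rw [List.flatMap_cons, List.isChain_append]
    refine ⟨h₁ a (by simp), ih (fun b hb => h₁ b (by simp [hb])) h₂.of_cons, ?_⟩
    intro x hx y hy
    cases l with
    | nil => simp at hy
    | cons b l =>
      obtain rfl : f b = y := by simpa using hy
      exact h₂.rel x hx

theorem map_getD_idxOf {α β : Type*} [DecidableEq α] {l : List α} (hl : l.Nodup) {Qs : List β}
    (h : Qs.length = l.length) (d : β) : (l.map fun a => Qs.getD (l.idxOf a) d) = Qs := by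
  refine List.ext_getElem (by simp [h]) fun i h1 h2 => ?_
  rw [List.getElem_map, hl.idxOf_getElem, List.getD_eq_getElem]

/-- The unmarked vertices in the component of `c (e + 1)` in the rest. -/
def spareSet {V : Type*} (G : SimpleGraph V) (c : ℕ → V) (D : Set V) (Z : Finset V) (e : ℕ) :
    Set V :=
  {x | (x ∈ restSet G c D ∧ x ∉ Z) ∧ (edgesWithin G (restSet G c D)).Reachable (c (e + 1)) x}

namespace IsObstruction

variable {V : Type*} {G : SimpleGraph V} {N : ℕ} {c : ℕ → V} {D : Set V} {Z : Finset V} {e : ℕ}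

theorem mem_spareSet_of_isLinkGap (H : IsObstruction G N c D) (hZ : IsMarking G N c D Z) {i j : ℕ}
    (hi : c i ∈ linkSet G c D) (hj : c j ∈ linkSet G c D) (hjN : j < N)
    (hm : ∀ m, i < m → m < j → c m ∈ restSet G c D)
    (hr : (edgesWithin G (restSet G c D)).Reachable (c (e + 1)) (c (i + 1))) {m : ℕ}
    (him : i < m) (hmj : m < j) : c m ∈ spareSet G c D Z e := by
  refine ⟨⟨hm m him hmj, hZ.notMem i j m him hmj hjN hi hj hm⟩, hr.trans ?_⟩
  refine edgesWithin_reachable_of_isChain (H.stretch_isChain (i + 1) (m - i)) ?_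
    (mem_stretch.2 ⟨i + 1, by omega, by omega, rfl⟩) (mem_stretch.2 ⟨m, by omega, by omega, rfl⟩)
  intro x hx
  obtain ⟨l, h1, h2, rfl⟩ := mem_stretch.1 hx
  exact hm l (by omega) (by omega)

theorem adj_of_mem_spareSet (H : IsObstruction G N c D) (hfree : P4P1Free G) {w x y : V}
    (hw : w ∈ linkSet G c D) (hx : x ∈ spareSet G c D Z e) (hwx : G.Adj w x)
    (hy : y ∈ spareSet G c D Z e) : G.Adj w y :=
  H.adj_of_reachable hfree hw hwx (hx.2.symm.trans hy.2)

theorem adj_start_of_isLinkGap (H : IsObstruction G N c D) (hfree : P4P1Free G)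
    (hZ : IsMarking G N c D Z) {i : ℕ} (hi : IsLinkGap G N c D i)
    (hr : (edgesWithin G (restSet G c D)).Reachable (c (e + 1)) (c (i + 1))) {x : V}
    (hx : x ∈ spareSet G c D Z e) : G.Adj (c i) x :=
  H.adj_of_mem_spareSet hfree hi.1 ⟨H.succ_mem_of_isLinkGap hfree hZ hi, hr⟩ (H.adj i) hx

theorem exists_end_of_isLinkGap (H : IsObstruction G N c D) (hfree : P4P1Free G)
    (hZ : IsMarking G N c D Z) {i : ℕ} (hi : IsLinkGap G N c D i)
    (hr : (edgesWithin G (restSet G c D)).Reachable (c (e + 1)) (c (i + 1))) :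
    ∃ j, i + 1 < j ∧ j < N ∧ c j ∈ linkSet G c D ∧
      (∀ m, i < m → m < j → c m ∈ spareSet G c D Z e) ∧
      ∀ x ∈ spareSet G c D Z e, G.Adj (c j) x := by
  obtain ⟨j, h1, h2, h3, h4⟩ := H.exists_of_isLinkGap hfree hi
  have h5 : ∀ m, i < m → m < j → c m ∈ spareSet G c D Z e := fun m =>
    H.mem_spareSet_of_isLinkGap hZ hi.1 h3 h2 h4 hr
  refine ⟨j, h1, h2, h3, h5, fun x hx => ?_⟩
  refine H.adj_of_mem_spareSet hfree h3 (h5 (j - 1) (by omega) (by omega)) ?_ hx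
  have := H.adj (j - 1)
  rw [Nat.sub_add_cancel (by omega)] at this
  exact this.symm

theorem adj_of_not_isLinkGap (H : IsObstruction G N c D) (hfree : P4P1Free G)
    (hZ : IsMarking G N c D Z) {i j : ℕ} (hij : i < j) (hjN : j ≤ N)
    (hi : c i ∉ spareSet G c D Z e) (hj : c j ∉ spareSet G c D Z e)
    (hm : ∀ m, i < m → m < j → c m ∈ spareSet G c D Z e)
    (hgap : ¬(IsLinkGap G N c D i ∧
      (edgesWithin G (restSet G c D)).Reachable (c (e + 1)) (c (i + 1)))) :
    G.Adj (c i) (c j) := by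
  by_cases hne : j = i + 1
  · rw [hne]
    exact H.adj i
  have hlt : i + 1 < j := by omega
  have hsucc := hm (i + 1) (by omega) hlt
  have hpred := hm (j - 1) (by omega) (by omega)
  have hadj := H.adj (j - 1)
  rw [Nat.sub_add_cancel (by omega)] at hadj
  have hiS : c i ∉ outerBoundary G D := fun h => hsucc.1.2 (hZ.succ_mem i h)
  have hjS : c j ∉ outerBoundary G D := fun h => hpred.1.2 (hZ.pred_mem (j - 1)
    (by rwa [Nat.sub_add_cancel (by omega)]) hpred.1.1)
  have hi0 : 0 < i := Nat.pos_of_ne_zero fun h => hiS (h ▸ H.zero_mem)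
  have hjN' : j < N := lt_of_le_of_ne hjN fun h => hjS (h ▸ H.apply_N_mem)
  by_cases hiW : c i ∈ linkSet G c D
  · by_cases hjW : c j ∈ linkSet G c D
    · exact (hgap ⟨⟨hiW, j, hij, hjN', hjW, fun m h1 h2 => (hm m h1 h2).1.1⟩, hsucc.2⟩).elim
    · have hjB : c j ∈ restSet G c D := ⟨H.notMem j, hjS, hjW⟩
      exact H.adj_of_reachable hfree hiW (H.adj i) ((hsucc.2.symm.trans hpred.2).trans
        (edgesWithin_adj_reachable hadj hpred.1.1 hjB))
  · have hiB : c i ∈ restSet G c D := ⟨H.notMem i, hiS, hiW⟩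
    by_cases hjW : c j ∈ linkSet G c D
    · exact (H.adj_of_reachable hfree hjW hadj.symm ((hpred.2.symm.trans hsucc.2).trans
        (edgesWithin_adj_reachable (H.adj i).symm hsucc.1.1 hiB))).symm
    · have hjB : c j ∈ restSet G c D := ⟨H.notMem j, hjS, hjW⟩
      refine hZ.adj i j hi0 hlt hjN' ?_ ?_ fun m h1 h2 => (hm m h1 h2).1
      · by_contra h
        exact hi ⟨⟨hiB, h⟩, hsucc.2.trans
          (edgesWithin_adj_reachable (H.adj i).symm hsucc.1.1 hiB)⟩
      · by_contra h
        exact hj ⟨⟨hjB, h⟩, hpred.2.trans (edgesWithin_adj_reachable hadj hpred.1.1 hjB)⟩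

end IsObstruction

namespace IsObstruction

variable {V : Type*} {G : SimpleGraph V} {N : ℕ} {c : ℕ → V} {D : Set V} {Z : Finset V} {e : ℕ}

/-- The paths covering the spare vertices can be inserted into the gaps of the cycle. -/
theorem false_of_component_paths (H : IsObstruction G N c D) (hfree : P4P1Free G)
    (hZ : IsMarking G N c D Z) {Qs : List (List V)} {M : Finset ℕ} (he : IsLinkGap G N c D e)
    (hQs : ∀ P ∈ Qs, P ≠ [] ∧ P.IsChain G.Adj) (hnodup : Qs.flatten.Nodup)
    (hmem : ∀ x, x ∈ Qs.flatten ↔ x ∈ spareSet G c D Z e)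
    (hM : ∀ i, i ∈ M ↔ IsLinkGap G N c D i ∧
      (edgesWithin G (restSet G c D)).Reachable (c (e + 1)) (c (i + 1)))
    (hlen : Qs.length + 1 = M.card) : False := by
  classical
  have h3 := H.three_le
  have heM : e ∈ M := (hM e).2 ⟨he, .refl _⟩
  have hMN : ∀ i ∈ M, i < N := fun i hi => by
    obtain ⟨j, h1, h2, -⟩ := ((hM i).1 hi).1.2
    omega
  have heN := hMN e heM
  have hboundary : ∀ u ∈ outerBoundary G D, u ∉ spareSet G c D Z e := fun u hu h =>
    h.1.1.2.1 hu
  have hlink : ∀ w ∈ linkSet G c D, w ∉ spareSet G c D Z e := fun w hw h => h.1.1.2.2 hw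
  let E : List ℕ := (M.erase e).toList
  have hE : E.Nodup := Finset.nodup_toList _
  have memE : ∀ i, i ∈ E ↔ i ≠ e ∧ i ∈ M := fun i => by
    rw [Finset.mem_toList, Finset.mem_erase]
  have hElen : Qs.length = E.length := by
    rw [Finset.length_toList, Finset.card_erase_of_mem heM]
    omega
  let ins : ℕ → List V := fun i => Qs.getD (E.idxOf (i % N)) []
  have ins_nil : ∀ i, i % N ∉ E → ins i = [] := fun i hi => by
    refine List.getD_eq_default _ _ ?_
    rw [List.idxOf_eq_length_iff.2 hi, hElen]
  have ins_mem : ∀ i, i % N ∈ E → ins i ∈ Qs := fun i hi => by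
    have hlt : E.idxOf (i % N) < Qs.length := hElen ▸ List.idxOf_lt_length_iff.2 hi
    change Qs.getD (E.idxOf (i % N)) [] ∈ Qs
    rw [List.getD_eq_getElem _ _ hlt]
    exact List.getElem_mem hlt
  let keep : ℕ → Bool := fun i => decide (c i ∉ spareSet G c D Z e)
  have keep_iff : ∀ i, keep i = true ↔ c i ∉ spareSet G c D Z e := fun i => by
    simp only [keep, decide_eq_true_eq]
  let L : List ℕ := (List.range' (e + 1) N).filter keep
  have memL : ∀ i, i ∈ L ↔ (e + 1 ≤ i ∧ i < e + 1 + N) ∧ c i ∉ spareSet G c D Z e := fun i => by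
    rw [List.mem_filter, List.mem_range'_1, keep_iff]
  let F : ℕ → List V := fun i => c i :: ins i
  let O : List V := L.flatMap F
  -- reduction of consecutive kept indices to indices at most `N`
  have hconsec : ∀ i j, i < j → c i ∉ spareSet G c D Z e → c j ∉ spareSet G c D Z e →
      (∀ m, i < m → m < j → c m ∈ spareSet G c D Z e) →
      ∃ j', c j' = c j ∧ i % N < j' ∧ j' ≤ N ∧
        ∀ m, i % N < m → m < j' → c m ∈ spareSet G c D Z e := by
    intro i j hij hi hj hm
    have hdiv := Nat.mod_add_div i N
    have hlt := Nat.mod_lt i (show 0 < N by omega)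
    have hshift : ∀ m, c (m + N * (i / N)) = c m := fun m => by
      rw [H.apply_eq_iff, Nat.add_mul_mod_self_left]
    have hjN : j ≤ N + N * (i / N) := by
      by_contra! h
      have := hm (N + N * (i / N)) (by omega) h
      rw [hshift] at this
      exact hboundary _ H.apply_N_mem this
    refine ⟨j - N * (i / N), ?_, by omega, by omega, fun m h1 h2 => ?_⟩
    · rw [← hshift, Nat.sub_add_cancel (by omega)]
    · rw [← hshift]
      exact hm _ (by omega) (by omega)
  have hchain : O.IsChain G.Adj := by
    refine isChain_flatMap_cons (fun i _ => ?_) (isChain_filter_range' ?_)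
    · by_cases hi : i % N ∈ E
      · refine List.isChain_cons.2 ⟨fun y hy => ?_, (hQs _ (ins_mem i hi)).2⟩
        obtain ⟨h1, h2⟩ := (hM _).1 ((memE _).1 hi).2
        have hyS : y ∈ spareSet G c D Z e := (hmem y).1
          (List.mem_flatten.2 ⟨_, ins_mem i hi, List.mem_of_mem_head? hy⟩)
        have := H.adj_start_of_isLinkGap hfree hZ h1 h2 hyS
        rwa [H.apply_mod] at this
      · rw [ins_nil i hi]
        exact List.isChain_singleton _
    · intro i j hei hij hj hki hkj hm x hx
      rw [keep_iff] at hki hkj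
      obtain ⟨j', hj', hij', hjN', hm'⟩ := hconsec i j hij hki hkj fun m h1 h2 => by
        have := hm m h1 h2
        rwa [keep_iff, not_not] at this
      rw [← H.apply_mod] at hki
      rw [← hj'] at hkj ⊢
      by_cases hi : i % N ∈ E
      · obtain ⟨h1, h2⟩ := (hM _).1 ((memE _).1 hi).2
        obtain ⟨j₂, h4, h5, h6, h7, h8⟩ := H.exists_end_of_isLinkGap hfree hZ h1 h2
        have hj₂ : j₂ = j' := by
          rcases lt_trichotomy j₂ j' with h | h | h
          · exact (hlink _ h6 (hm' j₂ (by omega) h)).elim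
          · exact h
          · exact (hkj (h7 j' hij' h)).elim
        have hne := (hQs _ (ins_mem i hi)).1
        rw [List.getLast?_cons_of_ne_nil hne] at hx
        rw [← hj₂]
        exact (h8 x ((hmem x).1 (List.mem_flatten.2
          ⟨_, ins_mem i hi, List.mem_of_mem_getLast? hx⟩))).symm
      · rw [ins_nil i hi] at hx
        obtain rfl : c i = x := by simpa using hx
        rw [← H.apply_mod i]
        refine H.adj_of_not_isLinkGap hfree hZ hij' hjN' hki hkj hm' fun h => ?_
        have hiM := (hM _).2 h
        have hie : i % N = e := by
          by_contra hne
          exact hi ((memE _).2 ⟨hne, hiM⟩)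
        have h1 := Nat.mod_add_div i N
        have h2 : i / N = 0 := by
          by_contra h0
          have := Nat.le_mul_of_pos_right N (Nat.pos_of_ne_zero h0)
          omega
        rw [h2] at h1
        omega
  have hperm : O.Perm (L.map c ++ Qs.flatten) := by
    have h1 : O.Perm (L.flatMap (fun i => [c i]) ++ L.flatMap ins) :=
      (List.flatMap_append_perm L (fun i => [c i]) ins).symm
    rw [← List.map_eq_flatMap] at h1
    refine h1.trans (List.Perm.append_left _ ?_)
    let g : ℕ → List V := fun i => Qs.getD (E.idxOf i) []
    have h2 : L.flatMap ins = (L.map (· % N)).flatMap g := by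
      rw [List.flatMap_map]
    have h4 : (L.map (· % N)).Nodup := by
      refine List.Nodup.map_on ?_ (List.Nodup.filter _ List.nodup_range')
      intro a ha b hb hab
      obtain ⟨ha, -⟩ := (memL a).1 ha
      obtain ⟨hb, -⟩ := (memL b).1 hb
      rw [← H.apply_eq_iff] at hab
      rcases lt_trichotomy a b with h | h | h
      · exact (H.apply_ne h (by omega) hab).elim
      · exact h
      · exact (H.apply_ne h (by omega) hab.symm).elim
    have h5 : ((L.map (· % N)).filter (· ∈ E)).Perm E := by
      refine (List.perm_ext_iff_of_nodup (h4.filter _) hE).2 fun i => ?_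
      rw [List.mem_filter, decide_eq_true_iff, and_iff_right_iff_imp]
      intro hi
      have hi' := (memE i).1 hi
      have hiN := hMN i hi'.2
      obtain ⟨k, h6, h7, h8⟩ := H.exists_index (e + 1) i
      refine List.mem_map.2 ⟨k, (memL k).2 ⟨⟨h6, h7⟩, ?_⟩, ?_⟩
      · rw [h8]
        exact hlink _ ((hM i).1 hi'.2).1.1
      · rw [H.apply_eq_iff, Nat.mod_eq_of_lt hiN] at h8
        exact h8
    have h6 := (List.filter_append_perm (fun i => decide (i ∈ E)) (L.map (· % N))).symm
    rw [h2]
    refine (h6.flatMap_right g).trans ?_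
    rw [List.flatMap_append]
    have h7 : ((L.map (· % N)).filter fun i => !decide (i ∈ E)).flatMap g = [] := by
      rw [List.flatMap_eq_nil_iff]
      intro i hi
      have hi : i ∉ E := by simpa using (List.mem_filter.1 hi).2
      refine List.getD_eq_default _ _ ?_
      rw [List.idxOf_eq_length_iff.2 hi, hElen]
    rw [h7, List.append_nil]
    refine (h5.flatMap_right g).trans ?_
    rw [List.flatMap_def, map_getD_idxOf hE hElen]
  have hsub : (L.map c).Sublist (stretch c (e + 1) N) := List.filter_sublist.map c
  have hO : O.Nodup := by
    rw [hperm.nodup_iff, List.nodup_append]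
    refine ⟨(H.stretch_nodup _ le_rfl).sublist hsub, hnodup, ?_⟩
    rintro a ha b hb rfl
    obtain ⟨i, hi, rfl⟩ := List.mem_map.1 ha
    exact ((memL i).1 hi).2 ((hmem _).1 hb)
  have hOD : ∀ x ∈ O, x ∉ D := by
    intro x hx
    rcases List.mem_append.1 (hperm.mem_iff.1 hx) with hx | hx
    · obtain ⟨i, -, rfl⟩ := List.mem_map.1 hx
      exact H.notMem i
    · exact ((hmem x).1 hx).1.1.1
  have hN : N ≤ O.length := by
    have hss : stretch c (e + 1) N ⊆ O := by
      intro x hx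
      obtain ⟨i, h1, h2, rfl⟩ := mem_stretch.1 hx
      rw [hperm.mem_iff, List.mem_append, hmem]
      by_cases hi : c i ∈ spareSet G c D Z e
      · exact Or.inr hi
      · exact Or.inl (List.mem_map_of_mem ((memL i).2 ⟨⟨h1, h2⟩, hi⟩))
    have := (List.subperm_of_subset (H.stretch_nodup (e + 1) le_rfl) hss).length_le
    rwa [length_stretch] at this
  -- decomposition of `O` at a kept index
  have hsplit : ∀ i j, i + j + 1 = N → c (e + 1 + i) ∉ spareSet G c D Z e →
      O = ((List.range' (e + 1) i).filter keep).flatMap F ++ F (e + 1 + i) ++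
        ((List.range' (e + 1 + i + 1) j).filter keep).flatMap F := by
    intro i j hij hi
    have h : List.range' (e + 1) N =
        List.range' (e + 1) i ++ (e + 1 + i) :: List.range' (e + 1 + i + 1) j := by
      rw [← List.range'_succ, List.range'_append_1, ← hij, Nat.add_assoc]
    change ((List.range' (e + 1) N).filter keep).flatMap F = _
    rw [h, List.filter_append, List.filter_cons, if_pos ((keep_iff _).2 hi), List.flatMap_append,
      List.flatMap_cons, List.append_assoc]
  obtain ⟨j₀, h4, h5, h6, h7, h8⟩ := H.exists_end_of_isLinkGap hfree hZ he (.refl _)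
  refine H.false_of_linked_ends hfree hO hchain hOD hN ?_ (v := c e) (v' := c j₀) ?_ ?_ he.1 h6
    (Or.inr ⟨c (e + 1), (H.succ_mem_of_isLinkGap hfree hZ he).1, H.adj e,
      h8 _ (h7 _ (by omega) h4)⟩)
  · intro u hu
    obtain ⟨i, rfl⟩ := H.cover u hu
    obtain ⟨k, hk1, hk2, hk⟩ := H.exists_index (e + 1) i
    rw [← hk] at hu ⊢
    have hkE : k ≠ e + N := by
      rintro rfl
      rw [H.periodic] at hu
      exact he.1.2.1 hu
    obtain ⟨a, rfl⟩ := Nat.exists_eq_add_of_le hk1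
    obtain ⟨b, hb⟩ := Nat.exists_eq_add_of_lt (show a + 1 < N by omega)
    have hnext : c (e + 1 + a + 1) ∉ spareSet G c D Z e := fun h => h.1.2 (hZ.succ_mem _ hu)
    have h := hsplit a (b + 1) (by omega) (hboundary _ hu)
    rw [List.range'_succ, List.filter_cons, if_pos ((keep_iff _).2 hnext), List.flatMap_cons] at h
    have hF : F (e + 1 + a) = [c (e + 1 + a)] := by
      change c _ :: ins _ = _
      rw [ins_nil]
      intro hE'
      have := ((hM _).1 ((memE _).1 hE').2).1.1.2.1
      rw [H.apply_mod] at this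
      exact this hu
    rw [hF] at h
    rw [H.nextOn_apply]
    rw [h, List.append_assoc]
    exact ⟨_, _, rfl⟩
  · obtain ⟨a, rfl⟩ := Nat.exists_eq_add_of_le (show e + 1 ≤ j₀ by omega)
    rw [hsplit a (N - a - 1) (by omega) (hlink _ h6)]
    have : (List.range' (e + 1) a).filter keep = [] := by
      rw [List.filter_eq_nil_iff]
      intro m hm
      rw [List.mem_range'_1] at hm
      rw [keep_iff, not_not]
      exact h7 m (by omega) (by omega)
    rw [this]
    rfl
  · have hlast : c (e + 1 + (N - 1)) = c e := by
      rw [show e + 1 + (N - 1) = e + N by omega, H.periodic]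
    rw [hsplit (N - 1) 0 (by omega) (by rw [hlast]; exact hlink _ he.1)]
    have hF : F (e + 1 + (N - 1)) = [c e] := by
      change c _ :: ins _ = _
      rw [hlast, ins_nil]
      rw [show e + 1 + (N - 1) = e + N by omega, Nat.add_mod_right, Nat.mod_eq_of_lt heN, memE]
      exact fun h => h.1 rfl
    rw [hF]
    simp

theorem false [Fintype V] (H : IsObstruction G N c D) (hfree : P4P1Free G) {t : ℝ}
    (ht : 4.5 ≤ t) (htough : Tough t G) : False := by
  classical
  have hS : ∀ x, x ∈ Finset.univ.filter (· ∈ outerBoundary G D) ↔ x ∈ outerBoundary G D := by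
    simp
  obtain ⟨Z, hZ, hcard⟩ := H.exists_isMarking hfree hS
  obtain ⟨A, Ps, hA, hPs, hlt⟩ := H.exists_isPathCover_lt hfree ht htough hS hZ hcard
  obtain ⟨e, Qs, M, he, h1, h2, h4, h5, h6⟩ := H.exists_component_paths hfree hZ hA hPs hlt
  exact H.false_of_component_paths hfree hZ he h1 h2 h4 h5 h6

end IsObstruction

section Assembly

variable {V : Type*} {G : SimpleGraph V}

theorem IsCycleList.adj_getElem {l : List V} (hl : IsCycleList G l) {i j : ℕ} (hi : i < l.length)
    (hj : j < l.length) (hij : (i + 1) % l.length = j) : G.Adj l[i] l[j] := by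
  have h3 := hl.three_le
  rcases Nat.lt_or_ge (i + 1) l.length with h | h
  · rw [Nat.mod_eq_of_lt h] at hij
    subst hij
    exact List.isChain_iff_getElem.1 hl.isChain i h
  · have hi' : i + 1 = l.length := by omega
    rw [hi', Nat.mod_self] at hij
    subst hij
    refine hl.closed _ ?_ _ ?_
    · rw [List.getLast?_eq_getElem?, show l.length - 1 = i by omega, List.getElem?_eq_getElem hi]
      rfl
    · rw [List.head?_eq_getElem?, List.getElem?_eq_getElem hj]
      rfl

/-- A longest cycle that misses a vertex of a tough graph is an obstruction. -/
theorem IsCycleList.exists_isObstruction [Fintype V] {t : ℝ} (ht : 0 < t) (htough : Tough t G)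
    {l : List V} (hl : IsCycleList G l) (hmax : ∀ l', IsCycleList G l' → l'.length ≤ l.length)
    {x₀ : V} (hx₀ : x₀ ∉ l) : ∃ c D, IsObstruction G l.length c D := by
  classical
  have h3 := hl.three_le
  let D : Set V := {d | (edgesWithin G {z | z ∉ l}).Reachable x₀ d}
  have hDl : ∀ d ∈ D, d ∉ l := fun d hd =>
    edgesWithin_reachable_induction (p := fun d => d ∉ l) hd hx₀ fun _ _ _ _ hb _ => hb
  have hcover : ∀ x ∈ outerBoundary G D, x ∈ l := by
    rintro x ⟨hxD, d, hd, hxd⟩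
    by_contra hx
    exact hxD (SimpleGraph.Reachable.trans hd (edgesWithin_adj_reachable hxd.symm (hDl d hd) hx))
  obtain ⟨u, hu⟩ : (outerBoundary G D).Nonempty := by
    by_contra hempty
    rw [Set.not_nonempty_iff_eq_empty] at hempty
    have key : ∀ y, (edgesWithin G {z | z ∉ (∅ : Finset V)}).Reachable x₀ y → y ∈ D := by
      intro y hy
      refine edgesWithin_reachable_induction (p := (· ∈ D)) hy (.refl _) ?_
      intro a b hab _ _ ha
      by_contra hb
      have : b ∈ outerBoundary G D := ⟨hb, a, ha, hab.symm⟩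
      rw [hempty] at this
      exact this
    have hl0 : l[0] ∈ l := List.getElem_mem _
    have hne : x₀ ≠ l[0] := fun h => hx₀ (h ▸ hl0)
    have hnr : ¬(edgesWithin G {z | z ∉ (∅ : Finset V)}).Reachable x₀ l[0] := fun h =>
      hDl _ (key _ h) hl0
    have h := htough.mul_card_le ht.le (X := ∅) (I := {x₀, l[0]}) (by simp) ?_ ?_
    · rw [Finset.card_pair hne, Finset.card_empty] at h
      push_cast at h
      linarith
    · intro x hx y hy hxy hr
      rw [Finset.mem_insert, Finset.mem_singleton] at hx hy
      rcases hx with rfl | rfl <;> rcases hy with rfl | rfl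
      · exact hxy rfl
      · exact hnr hr
      · exact hnr hr.symm
      · exact hxy rfl
    · rw [Finset.card_pair hne]
  obtain ⟨r, hr, rfl⟩ := List.getElem_of_mem (hcover u hu)
  have hlt : ∀ i, (i + r) % l.length < l.length := fun i => Nat.mod_lt _ (by omega)
  refine ⟨fun i => l[(i + r) % l.length]'(hlt i), D, h3, fun i => ?_, fun i => ?_, ?_, ?_,
    ⟨x₀, .refl _⟩, ?_, ?_, ?_⟩
  · refine hl.adj_getElem _ _ ?_
    rw [Nat.mod_add_mod]
    congr 1
    omega
  · have : (i + l.length + r) % l.length = (i + r) % l.length := by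
      rw [show i + l.length + r = i + r + l.length by omega, Nat.add_mod_right]
    simp only [this]
  · intro i j hi hj hij
    have h := (hl.nodup.getElem_inj_iff).1 hij
    have := Nat.ModEq.add_right_cancel' r h
    rwa [Nat.ModEq, Nat.mod_eq_of_lt hi, Nat.mod_eq_of_lt hj] at this
  · exact fun i hi => hDl _ hi (List.getElem_mem _)
  · intro x hx
    obtain ⟨s, hs, rfl⟩ := List.getElem_of_mem (hcover x hx)
    have : (s + (l.length - r) + r) % l.length = s := by
      rw [show s + (l.length - r) + r = s + l.length by omega, Nat.add_mod_right,
        Nat.mod_eq_of_lt hs]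
    exact ⟨s + (l.length - r), by simp only [this]⟩
  · simpa only [Nat.zero_add, Nat.mod_eq_of_lt hr] using hu
  · intro M u v hM hchain hMD hlen hhead hlast hu hv
    obtain ⟨l', hl', hlt⟩ := exists_isCycleList_of_outerBoundary (D := D) (fun _ => Iff.rfl) hM
      hchain hMD hhead hlast hu hv (by omega)
    have := hmax l' hl'
    omega

end Assembly

theorem stmt16 {V : Type*} [Fintype V] [DecidableEq V] (G : SimpleGraph V) [DecidableRel G.Adj]
    (t : ℝ) (ht : 4.5 ≤ t) (htough : Tough t G) (hfree : P4P1Free G)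
    (v0 : V) (C : G.Walk v0 v0) (hC : C.IsCycle)
    (hlen : 3 * (Fintype.card V : ℝ) / (t + 1) ≤ ({v : V | v ∈ C.support}.ncard : ℝ))
    (hdeg : ∀ x : V, x ∉ C.support →
      3 * (Fintype.card V : ℝ) / (t + 1) ≤ (G.degree x : ℝ)) :
    ∃ a, ∃ p : G.Walk a a, p.IsHamiltonianCycle := by
  obtain ⟨l, hl, hmax⟩ := (IsCycleList.of_isCycle hC).exists_longest
  refine hl.exists_isHamiltonianCycle fun x => ?_
  by_contra hx
  obtain ⟨c, D, H⟩ := hl.exists_isObstruction (by linarith) htough hmax hx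
  exact H.false hfree ht htough
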